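/- arXiv:0911.2442 — 10 statements merged into one kernel-verified Lean document; each statement's English description precedes it below -/
import Mathlib

section
/- Let n ≥ 1 and let V = {v_1,…,v_m} be a linearly independent set of vectors in ℝ^n. Let L be the set of unit vectors of the form x/‖x‖ where x is a nonzero linear combination of v_1,…,v_m with nonnegative coefficients (the spherical simplex spanned by the radial projections of the v_i). Suppose Z ⊆ L is compact and connected. Then there exists a walk c : [0,∞) → ℝ^n over V with c(0) = 0 such that ‖c(t)‖ → ∞ as t → ∞ and the radial limit set of c is exactly Z. -/
open Filter

/-- A walk over a finite family of vectors `v : Fin m → ℝ^n`: there is a sequence of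
indices `j` such that on each interval `[k, k+1]` the path moves affinely from `c k`
to `c k + v (j k)`. -/
def IsWalk {n m : ℕ} (v : Fin m → EuclideanSpace ℝ (Fin n))
    (c : ℝ → EuclideanSpace ℝ (Fin n)) : Prop :=
  ∃ j : ℕ → Fin m, ∀ k : ℕ, ∀ t ∈ Set.Icc (k : ℝ) ((k : ℝ) + 1),
    c t = c (k : ℝ) + (t - (k : ℝ)) • v (j k)

/-- The radial limit set of a path `c`: the set of unit vectors `q` which are limits of
`c (a k) / ‖c (a k)‖` for some sequence `a k → ∞` of nonnegative reals. -/
def radialLimitSet {n : ℕ} (c : ℝ → EuclideanSpace ℝ (Fin n)) :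
    Set (EuclideanSpace ℝ (Fin n)) :=
  {q | ∃ a : ℕ → ℝ, (∀ k, 0 ≤ a k) ∧ Tendsto a atTop atTop ∧
    Tendsto (fun k => ‖c (a k)‖⁻¹ • c (a k)) atTop (nhds q)}

lemma Relation.TransGen.exists_nat_chain {α : Type*} {R : α → α → Prop} {a b : α}
    (h : Relation.TransGen R a b) :
    ∃ (l : ℕ) (f : ℕ → α), f 0 = a ∧ f (l + 1) = b ∧ ∀ i ≤ l, R (f i) (f (i + 1)) := by
  induction h using Relation.TransGen.head_induction_on with
  | single h =>
    exact ⟨0, fun i => Nat.casesOn i _ fun _ => b, rfl, rfl, fun i hi => by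
      obtain rfl : i = 0 := by omega
      exact h⟩
  | @head a c hac _ ih =>
    obtain ⟨l, f, h0, hl, hf⟩ := ih
    refine ⟨l + 1, fun i => Nat.casesOn i a f, rfl, hl, fun i hi => ?_⟩
    cases i with
    | zero => simpa [h0] using hac
    | succ i => exact hf i (by omega)

/-- Concatenation of countably many finite chains. -/
lemma exists_seq_chain_through {α : Type*} {R : α → α → Prop} {s : ℕ → α}
    (h : ∀ n, Relation.TransGen R (s n) (s (n + 1))) :
    ∃ z : ℕ → α, (∀ k, R (z k) (z (k + 1))) ∧
      ∃ g : ℕ → ℕ, StrictMono g ∧ ∀ n, z (g n) = s n := by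
  choose l f h0 hl hf using fun n => (h n).exists_nat_chain
  let next : ℕ × ℕ → ℕ × ℕ := fun p => if p.2 < l p.1 then (p.1, p.2 + 1) else (p.1 + 1, 0)
  let st : ℕ → ℕ × ℕ := fun k => next^[k] (0, 0)
  have st_succ (k : ℕ) : st (k + 1) = next (st k) := Function.iterate_succ_apply' _ _ _
  have inv (k : ℕ) : (st k).2 ≤ l (st k).1 := by
    induction k with
    | zero => exact Nat.zero_le _
    | succ k ih =>
      rw [st_succ]
      simp only [next]
      split_ifs with hk
      · exact hk
      · exact Nat.zero_le _
  let g : ℕ → ℕ := fun n => ∑ i ∈ Finset.range n, (l i + 1)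
  have g_succ (n : ℕ) : g (n + 1) = g n + (l n + 1) := Finset.sum_range_succ _ _
  have visit (n : ℕ) (hn : st (g n) = (n, 0)) (i : ℕ) (hi : i ≤ l n) :
      st (g n + i) = (n, i) := by
    induction i with
    | zero => exact hn
    | succ i ih =>
      rw [← add_assoc, st_succ, ih (by omega)]
      simp only [next]
      rw [if_pos (by omega)]
  have st_g (n : ℕ) : st (g n) = (n, 0) := by
    induction n with
    | zero => rfl
    | succ n ih =>
      rw [g_succ, ← add_assoc, st_succ, visit n ih (l n) le_rfl]
      simp [next]
  refine ⟨fun k => f (st k).1 (st k).2, fun k => ?_, g,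
    strictMono_nat_of_lt_succ fun n => by rw [g_succ]; omega, fun n => ?_⟩
  · have hR := hf _ _ (inv k)
    have hk := inv k
    simp only [st_succ, next]
    split_ifs with hlt
    · exact hR
    · have he : (st k).2 = l (st k).1 := by omega
      simp only [h0, ← hl]
      rw [← he]
      exact hR
  · simp only [st_g, h0]

lemma reflTransGen_dist_lt {X : Type*} [PseudoMetricSpace X] [PreconnectedSpace X] {ε : ℝ}
    (hε : 0 < ε) (x y : X) : Relation.ReflTransGen (fun a b : X => dist a b < ε) x y := by
  have hclopen : IsClopen {y | Relation.ReflTransGen (fun a b : X => dist a b < ε) x y} := by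
    refine ⟨⟨Metric.isOpen_iff.2 fun z hz => ⟨ε, hε, fun w hw hxw => hz ?_⟩⟩,
      Metric.isOpen_iff.2 fun z hz => ⟨ε, hε, fun w hw => ?_⟩⟩
    · exact hxw.tail hw
    · exact hz.tail (by rw [dist_comm]; exact hw)
  have := hclopen.eq_univ ⟨x, Relation.ReflTransGen.refl⟩
  exact this.symm.subset (Set.mem_univ y)

/-- In a connected separable space there is a sequence with vanishing step sizes that
accumulates at every point. -/
lemma exists_seq_dist_tendsto_zero_forall_mapClusterPt (X : Type*) [PseudoMetricSpace X]
    [ConnectedSpace X] [TopologicalSpace.SeparableSpace X] :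
    ∃ P : ℕ → X, Tendsto (fun k => dist (P k) (P (k + 1))) atTop (nhds 0) ∧
      ∀ x, MapClusterPt x atTop P := by
  let u : ℕ → X := fun n => TopologicalSpace.denseSeq X n.unpair.1
  let R : ℕ × X → ℕ × X → Prop := fun a b => a.1 ≤ b.1 ∧ dist a.2 b.2 < 1 / ((a.1 : ℝ) + 1)
  have pos (n : ℕ) : (0 : ℝ) < 1 / ((n : ℝ) + 1) := by positivity
  have hs (n : ℕ) : Relation.TransGen R (n, u n) (n + 1, u (n + 1)) := by
    refine Relation.TransGen.tail' (b := (n, u (n + 1))) ?_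
      ⟨Nat.le_succ n, by simpa using pos n⟩
    exact (reflTransGen_dist_lt (pos n) (u n) (u (n + 1))).lift (fun x => (n, x))
      fun a b hab => ⟨le_rfl, hab⟩
  obtain ⟨z, hz, g, hg, hzg⟩ := exists_seq_chain_through (s := fun n => (n, u n)) hs
  have hmono : Monotone fun k => (z k).1 := monotone_nat_of_le_succ fun k => (hz k).1
  refine ⟨fun k => (z k).2, ?_, fun x => ?_⟩
  · refine Metric.tendsto_atTop.2 fun ε hε => ?_
    obtain ⟨n, hn⟩ := exists_nat_one_div_lt hε
    refine ⟨g n, fun k hk => ?_⟩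
    have hnk : n ≤ (z k).1 := by simpa [hzg] using hmono hk
    rw [Real.dist_0_eq_abs, abs_of_nonneg dist_nonneg]
    exact ((hz k).2.trans_le (one_div_le_one_div_of_le (by positivity) (by gcongr))).trans hn
  · refine mapClusterPt_iff_frequently.2 fun s hs => frequently_atTop.2 fun N => ?_
    obtain ⟨i, hi⟩ := (TopologicalSpace.denseRange_denseSeq X).exists_mem_open
      isOpen_interior ⟨x, mem_interior_iff_mem_nhds.2 hs⟩
    refine ⟨g (Nat.pair i N), (Nat.right_le_pair i N).trans (hg.le_apply), ?_⟩
    simpa [hzg, u] using interior_subset hi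

lemma tendsto_sum_two_pow_mul_div {δ : ℕ → ℝ} (hδ : Tendsto δ atTop (nhds 0)) :
    Tendsto (fun k => (1 + ∑ i ∈ Finset.range k, 2 ^ (i + 1) * δ i) / 2 ^ k) atTop (nhds 0) := by
  have h1 : (fun i => 2 ^ (i + 1) * δ i) =o[atTop] fun i => (2 : ℝ) ^ i := by
    refine (Asymptotics.isLittleO_iff_tendsto fun i hi => absurd hi (by positivity)).2 ?_
    have := hδ.const_mul 2
    rw [mul_zero] at this
    refine this.congr fun i => ?_
    field_simp
    ring
  have h2 (n : ℕ) : ∑ i ∈ Finset.range n, (2 : ℝ) ^ i = 2 ^ n - 1 := by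
    rw [geom_sum_eq (by norm_num)]; norm_num
  have hpow : Tendsto (fun n : ℕ => (2 : ℝ) ^ n) atTop atTop :=
    tendsto_pow_atTop_atTop_of_one_lt one_lt_two
  have h3 := h1.sum_range (fun i => by positivity) (by
    simp only [h2]
    exact tendsto_atTop_add_const_right _ _ hpow)
  have h4 : (fun n => ∑ i ∈ Finset.range n, 2 ^ (i + 1) * δ i) =o[atTop]
      fun n => (2 : ℝ) ^ n := by
    refine h3.trans_isBigO (Asymptotics.IsBigO.of_bound 1 (Eventually.of_forall fun n => ?_))
    rw [h2, one_mul, Real.norm_of_nonneg (by linarith [one_le_pow₀ (n := n) one_le_two (M₀ := ℝ)]),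
      Real.norm_of_nonneg (by positivity)]
    linarith
  have h5 := (hpow.inv_tendsto_atTop).add h4.tendsto_div_nhds_zero
  rw [add_zero] at h5
  refine h5.congr fun n => ?_
  simp only [Pi.inv_apply]
  field_simp

lemma Nat.tendsto_log_two_atTop : Tendsto (Nat.log 2) atTop atTop :=
  tendsto_atTop_atTop.2 fun b => ⟨2 ^ b, fun _ ha => Nat.le_log_of_pow_le one_lt_two ha⟩

/-- Greedy apportionment: unit steps along the coordinate axes can be chosen so that the
averaged position follows a sequence in the simplex which is run at logarithmic speed. -/
lemma exists_steps_tendsto_average {m : ℕ} {P : ℕ → Fin m → ℝ}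
    (hP : ∀ k, P k ∈ stdSimplex ℝ (Fin m))
    (hδ : Tendsto (fun k => dist (P k) (P (k + 1))) atTop (nhds 0)) :
    ∃ j : ℕ → Fin m, Tendsto (fun N : ℕ => (N : ℝ)⁻¹ •
      (∑ k ∈ Finset.range N, Pi.single (M := fun _ => ℝ) (j k) 1) - P (Nat.log 2 N))
      atTop (nhds 0) := by
  have pick (N : ℕ) (y : Fin m → ℝ) : ∃ i, ∑ i, y i = N →
      y i < ((N : ℝ) + 1) * P (Nat.log 2 (N + 1)) i := by
    by_cases hy : ∑ i, y i = N
    · have : ∑ i, y i < ∑ i, ((N : ℝ) + 1) * P (Nat.log 2 (N + 1)) i := by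
        rw [← Finset.mul_sum, (hP _).2, hy]; linarith
      obtain ⟨i, -, hi⟩ := Finset.exists_lt_of_sum_lt this
      exact ⟨i, fun _ => hi⟩
    · have : Nonempty (Fin m) := by
        by_contra hne
        rw [not_nonempty_iff] at hne
        simpa using (hP 0).2
      exact ⟨Classical.arbitrary _, fun h => absurd h hy⟩
  choose i hi using pick
  let x : ℕ → Fin m → ℝ := fun N => Nat.rec 0 (fun N y => y + Pi.single (i N y) 1) N
  have x_succ (N : ℕ) : x (N + 1) = x N + Pi.single (i N (x N)) 1 := rfl
  have x_eq (N : ℕ) :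
      x N = ∑ k ∈ Finset.range N, Pi.single (M := fun _ => ℝ) (i k (x k)) 1 := by
    induction N with
    | zero => rfl
    | succ N ih => rw [Finset.sum_range_succ, ← ih, x_succ]
  have x_sum (N : ℕ) : ∑ a, x N a = N := by
    induction N with
    | zero => simp [x]
    | succ N ih => simp [x_succ, Finset.sum_add_distrib, ih]
  let B : ℕ → ℝ := fun k => 1 + ∑ i ∈ Finset.range k, 2 ^ (i + 1) * dist (P i) (P (i + 1))
  have B_one (k : ℕ) : 1 ≤ B k := le_add_of_nonneg_right (by positivity)
  have bound (N : ℕ) (a : Fin m) : x N a ≤ N * P (Nat.log 2 N) a + B (Nat.log 2 N) := by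
    induction N with
    | zero => simpa [x] using zero_le_one.trans (B_one 0)
    | succ N ih =>
      rw [x_succ, Pi.add_apply]
      by_cases ha : a = i N (x N)
      · have := hi N (x N) (x_sum N)
        rw [← ha] at this ⊢
        rw [Pi.single_eq_same]
        push_cast
        linarith [B_one (Nat.log 2 (N + 1))]
      · rw [Pi.single_eq_of_ne ha, add_zero]
        refine ih.trans ?_
        have hnn := (hP (Nat.log 2 (N + 1))).1 a
        push_cast
        rcases (Nat.log_mono_right (b := 2) (Nat.le_succ N)).eq_or_lt with he | hlt
        · rw [Nat.succ_eq_add_one] at he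
          rw [he]
          linarith
        · have hNlt := Nat.lt_pow_succ_log_self one_lt_two N
          have hle : Nat.log 2 (N + 1) = Nat.log 2 N + 1 := by
            refine le_antisymm ?_ hlt
            exact (Nat.log_mono_right hNlt).trans (Nat.log_pow one_lt_two _).le
          rw [hle] at hnn ⊢
          have hd : P (Nat.log 2 N) a - P (Nat.log 2 N + 1) a
              ≤ dist (P (Nat.log 2 N)) (P (Nat.log 2 N + 1)) :=
            (le_abs_self _).trans (dist_le_pi_dist (P (Nat.log 2 N)) (P (Nat.log 2 N + 1)) a)
          have hN : (N : ℝ) ≤ 2 ^ (Nat.log 2 N + 1) := by exact_mod_cast hNlt.le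
          have hB : B (Nat.log 2 N + 1) = B (Nat.log 2 N) + 2 ^ (Nat.log 2 N + 1) *
              dist (P (Nat.log 2 N)) (P (Nat.log 2 N + 1)) := by
            simp only [B, Finset.sum_range_succ, add_assoc]
          rw [hB]
          have h1 := mul_le_mul_of_nonneg_left hd (Nat.cast_nonneg (α := ℝ) N)
          have h2 := mul_le_mul_of_nonneg_right hN
            (dist_nonneg (x := P (Nat.log 2 N)) (y := P (Nat.log 2 N + 1)))
          linarith
  refine ⟨fun N => i N (x N), ?_⟩
  simp only [← x_eq]
  have hB := (tendsto_sum_two_pow_mul_div hδ).comp Nat.tendsto_log_two_atTop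
  replace hB := hB.const_mul (m : ℝ)
  rw [mul_zero] at hB
  refine squeeze_zero_norm' ?_ hB
  filter_upwards [eventually_gt_atTop 0] with N hN
  have hN' : (0 : ℝ) < N := by exact_mod_cast hN
  set p := P (Nat.log 2 N) with hp
  set e : ℝ := B (Nat.log 2 N) / 2 ^ Nat.log 2 N with he
  have he0 : 0 ≤ e := div_nonneg (zero_le_one.trans (B_one _)) (by positivity)
  have upper (a : Fin m) : (N : ℝ)⁻¹ * x N a - p a ≤ e := by
    have h1 : (2 : ℝ) ^ Nat.log 2 N ≤ N := by exact_mod_cast Nat.pow_log_le_self 2 hN.ne'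
    have h2 : B (Nat.log 2 N) / N ≤ e :=
      div_le_div_of_nonneg_left (zero_le_one.trans (B_one _)) (by positivity) h1
    have h3 := mul_le_mul_of_nonneg_left (bound N a) (inv_nonneg.2 hN'.le)
    rw [mul_add, inv_mul_cancel_left₀ hN'.ne', ← div_eq_inv_mul (B _)] at h3
    linarith
  have hsum : ∑ a, ((N : ℝ)⁻¹ * x N a - p a) = 0 := by
    rw [Finset.sum_sub_distrib, ← Finset.mul_sum, x_sum, (hP _).2, inv_mul_cancel₀ hN'.ne',
      sub_self]
  refine (pi_norm_le_iff_of_nonneg (by positivity)).2 fun a => ?_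
  change |(N : ℝ)⁻¹ * x N a - p a| ≤ m * e
  have hm : (1 : ℝ) ≤ m := by exact_mod_cast (Fin.pos a)
  refine abs_le.2 ⟨?_, (upper a).trans (le_mul_of_one_le_left he0 hm)⟩
  rw [← Finset.add_sum_erase _ _ (Finset.mem_univ a)] at hsum
  have h4 := Finset.sum_le_card_nsmul (Finset.univ.erase a)
    (fun a => (N : ℝ)⁻¹ * x N a - p a) e fun b _ => upper b
  rw [Finset.card_erase_of_mem (Finset.mem_univ a), Finset.card_fin, nsmul_eq_mul,
    Nat.cast_sub (Fin.pos a)] at h4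
  push_cast at h4
  linarith

lemma norm_inv_norm_smul_sub_inv_norm_smul_le {E : Type*} [NormedAddCommGroup E]
    [NormedSpace ℝ E] (a : E) {b : E} (hb : b ≠ 0) :
    ‖‖a‖⁻¹ • a - ‖b‖⁻¹ • b‖ ≤ 2 * ‖a - b‖ / ‖b‖ := by
  have hb' : 0 < ‖b‖ := norm_pos_iff.2 hb
  rcases eq_or_ne a 0 with rfl | ha
  · simp only [norm_zero, smul_zero, zero_sub, norm_neg, norm_smul, norm_inv, norm_norm]
    rw [inv_mul_cancel₀ hb'.ne', mul_div_assoc, div_self hb'.ne']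
    norm_num
  · have ha' : 0 < ‖a‖ := norm_pos_iff.2 ha
    have h1 : ‖a‖⁻¹ • a - ‖b‖⁻¹ • b = ‖b‖⁻¹ • (a - b) + (‖a‖⁻¹ - ‖b‖⁻¹) • a := by
      module
    have h2 : ‖(‖a‖⁻¹ - ‖b‖⁻¹) • a‖ = |‖b‖ - ‖a‖| / ‖b‖ := by
      rw [norm_smul, Real.norm_eq_abs, ← abs_of_pos hb', ← abs_div, abs_of_pos hb',
        ← abs_of_pos ha', ← abs_mul, abs_of_pos ha']
      congr 1
      field_simp
    have h3 : ‖‖b‖⁻¹ • (a - b)‖ = ‖a - b‖ / ‖b‖ := by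
      rw [norm_smul, norm_inv, norm_norm, div_eq_inv_mul]
    have h4 : |‖b‖ - ‖a‖| ≤ ‖a - b‖ := by
      rw [norm_sub_rev]; exact abs_norm_sub_norm_le b a
    rw [h1, two_mul, add_div]
    refine (norm_add_le _ _).trans ?_
    rw [h2, h3]
    gcongr

/-- If the direction of a path shadows a sequence in a closed set that accumulates at each
of its points, then the radial limit set is that closed set. -/
lemma radialLimitSet_eq_of_tendsto {n : ℕ} {c : ℝ → EuclideanSpace ℝ (Fin n)}
    {z : ℕ → EuclideanSpace ℝ (Fin n)} {Z : Set (EuclideanSpace ℝ (Fin n))}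
    (hZ : IsClosed Z) (hz : ∀ N, z N ∈ Z)
    (hcz : Tendsto (fun t => ‖c t‖⁻¹ • c t - z ⌊t⌋₊) atTop (nhds 0))
    (hacc : ∀ q ∈ Z, ∃ φ : ℕ → ℕ, Tendsto φ atTop atTop ∧
      Tendsto (fun k => z (φ k)) atTop (nhds q)) :
    radialLimitSet c = Z := by
  ext q
  constructor
  · rintro ⟨a, -, ha, hq⟩
    have h := hq.sub (hcz.comp ha)
    simp only [Function.comp_def, sub_sub_cancel, sub_zero] at h
    exact hZ.mem_of_tendsto h (Eventually.of_forall fun k => hz _)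
  · intro hq
    obtain ⟨φ, hφ, hφq⟩ := hacc q hq
    have ha : Tendsto (fun k => (φ k : ℝ)) atTop atTop := tendsto_natCast_atTop_atTop.comp hφ
    refine ⟨fun k => φ k, fun k => Nat.cast_nonneg _, ha, ?_⟩
    have h := (hcz.comp ha).add hφq
    simpa [Function.comp_def] using h

/-- The piecewise affine path with successive increments `w k`. -/
noncomputable def stepPath {E : Type*} [AddCommGroup E] [Module ℝ E] (w : ℕ → E) (t : ℝ) : E :=
  ∑ k ∈ Finset.range ⌊t⌋₊, w k + (t - ⌊t⌋₊) • w ⌊t⌋₊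

lemma stepPath_natCast {E : Type*} [AddCommGroup E] [Module ℝ E] (w : ℕ → E) (k : ℕ) :
    stepPath w k = ∑ i ∈ Finset.range k, w i := by
  simp [stepPath]

lemma isWalk_stepPath {n m : ℕ} (v : Fin m → EuclideanSpace ℝ (Fin n)) (j : ℕ → Fin m) :
    IsWalk v (stepPath fun k => v (j k)) := by
  refine ⟨j, fun k t ht => ?_⟩
  rw [stepPath_natCast]
  rcases ht.2.eq_or_lt with rfl | hlt
  · rw [← Nat.cast_succ, stepPath_natCast, Finset.sum_range_succ]
    simp
  · have hfl : ⌊t⌋₊ = k := (Nat.floor_eq_iff ((Nat.cast_nonneg k).trans ht.1)).2 ⟨ht.1, hlt⟩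
    rw [stepPath, hfl]

/-- The average velocity of a path with bounded increments shadows any sequence shadowed by the
averages of the increments. -/
lemma tendsto_inv_floor_smul_stepPath_sub {E : Type*} [NormedAddCommGroup E] [NormedSpace ℝ E]
    {w y : ℕ → E} {M : ℝ} (hM : ∀ k, ‖w k‖ ≤ M)
    (h : Tendsto (fun N : ℕ => (N : ℝ)⁻¹ • ∑ k ∈ Finset.range N, w k - y N) atTop (nhds 0)) :
    Tendsto (fun t : ℝ => (⌊t⌋₊ : ℝ)⁻¹ • stepPath w t - y ⌊t⌋₊) atTop (nhds 0) := by
  have hfloor : Tendsto (fun t : ℝ => ⌊t⌋₊) atTop atTop := tendsto_nat_floor_atTop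
  have h1 : Tendsto (fun t : ℝ => (⌊t⌋₊ : ℝ)⁻¹ • ((t - ⌊t⌋₊) • w ⌊t⌋₊)) atTop (nhds 0) := by
    have h2 : Tendsto (fun t : ℝ => (⌊t⌋₊ : ℝ)⁻¹ * M) atTop (nhds 0) := by
      simpa using (tendsto_inv_atTop_zero.comp
        ((tendsto_natCast_atTop_atTop (R := ℝ)).comp hfloor)).mul_const M
    refine squeeze_zero_norm' ?_ h2
    filter_upwards [eventually_ge_atTop 0] with t ht
    rw [norm_smul, norm_smul, norm_inv, Real.norm_natCast]
    have h3 : ‖t - ⌊t⌋₊‖ ≤ 1 := by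
      rw [Real.norm_of_nonneg (by linarith [Nat.floor_le ht])]
      linarith [Nat.lt_floor_add_one t]
    have h4 := mul_le_mul h3 (hM ⌊t⌋₊) (norm_nonneg _) zero_le_one
    rw [one_mul] at h4
    gcongr
  have h5 := (h.comp hfloor).add h1
  rw [add_zero] at h5
  refine h5.congr fun t => ?_
  simp only [Function.comp_def, stepPath, smul_add]
  abel

lemma UniformContinuous.tendsto_dist_comp {X Y ι : Type*} [PseudoMetricSpace X]
    [PseudoMetricSpace Y] {f : X → Y} (hf : UniformContinuous f) {l : Filter ι} {a b : ι → X}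
    (h : Tendsto (fun k => dist (a k) (b k)) l (nhds 0)) :
    Tendsto (fun k => dist (f (a k)) (f (b k))) l (nhds 0) := by
  have h' : Tendsto (fun k => (a k, b k)) l (uniformity X) :=
    tendsto_uniformity_iff_dist_tendsto_zero.2 h
  exact tendsto_uniformity_iff_dist_tendsto_zero.1 (Tendsto.comp hf h')

/-- Barycentric coordinates on the spherical simplex. -/
lemma exists_barycentric_coordinates {n m : ℕ}
    {v : Fin m → EuclideanSpace ℝ (Fin n)} (hv : LinearIndependent ℝ v)
    {Z : Set (EuclideanSpace ℝ (Fin n))}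
    (hZL : Z ⊆ {y | ∃ x : EuclideanSpace ℝ (Fin n), x ≠ 0 ∧
      (∃ t : Fin m → ℝ, (∀ i, 0 ≤ t i) ∧ x = ∑ i, t i • v i) ∧ y = ‖x‖⁻¹ • x}) :
    ∃ (σ : EuclideanSpace ℝ (Fin n) → ℝ) (π : Z → Fin m → ℝ), Continuous σ ∧ Continuous π ∧
      (∀ z ∈ Z, ‖z‖ = 1) ∧ (∀ z ∈ Z, 0 < σ z) ∧ (∀ z, π z ∈ stdSimplex ℝ (Fin m)) ∧
      ∀ z : Z, Fintype.linearCombination ℝ v (π z) = (σ z)⁻¹ • (z : EuclideanSpace ℝ (Fin n)) := by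
  let A := Fintype.linearCombination ℝ v
  obtain ⟨h, hh⟩ := A.exists_leftInverse_of_injective
    (LinearMap.ker_eq_bot.2 hv.fintypeLinearCombination_injective)
  have hA (t : Fin m → ℝ) : h (A t) = t := LinearMap.congr_fun hh t
  have hcont : Continuous h := h.continuous_of_finiteDimensional
  let σ : EuclideanSpace ℝ (Fin n) → ℝ := fun z => ∑ i, h z i
  have σ_cont : Continuous σ := by fun_prop
  have hZ (z) (hz : z ∈ Z) : ‖z‖ = 1 ∧ A (h z) = z ∧ ∀ i, 0 ≤ h z i := by
    obtain ⟨x, hx, ⟨t, ht, hxt⟩, rfl⟩ := hZL hz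
    have hxA : x = A t := by rw [hxt]; exact (Fintype.linearCombination_apply ℝ v t).symm
    have hhx : h x = t := by rw [hxA, hA]
    refine ⟨norm_smul_inv_norm hx, ?_, fun i => ?_⟩
    · rw [map_smul, map_smul, hhx, ← hxA]
    · rw [map_smul, hhx]
      exact mul_nonneg (by positivity) (ht i)
  have σ_pos (z) (hz : z ∈ Z) : 0 < σ z := by
    obtain ⟨h1, h2, h3⟩ := hZ z hz
    refine (Finset.sum_nonneg fun i _ => h3 i).lt_of_ne' fun h0 => ?_
    have h4 : h z = 0 := funext fun i =>
      (Finset.sum_eq_zero_iff_of_nonneg fun i _ => h3 i).1 h0 i (Finset.mem_univ i)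
    rw [← h2, h4, map_zero, norm_zero] at h1
    exact zero_ne_one h1
  let π : Z → Fin m → ℝ := fun z => (σ z)⁻¹ • h z
  have σ_cont' : Continuous fun z : Z => σ z := σ_cont.comp continuous_subtype_val
  have π_cont : Continuous π :=
    (σ_cont'.inv₀ fun z => (σ_pos z z.2).ne').smul (hcont.comp continuous_subtype_val)
  have π_mem (z : Z) : π z ∈ stdSimplex ℝ (Fin m) := by
    refine ⟨fun i => mul_nonneg (inv_nonneg.2 (σ_pos z z.2).le) ((hZ z z.2).2.2 i), ?_⟩
    simp only [π, Pi.smul_apply, smul_eq_mul, ← Finset.mul_sum]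
    exact inv_mul_cancel₀ (σ_pos z z.2).ne'
  refine ⟨σ, π, σ_cont, π_cont, fun z hz => (hZ z hz).1, σ_pos, π_mem, fun z => ?_⟩
  change A ((σ z)⁻¹ • h z) = _
  rw [map_smul, (hZ z z.2).2.1]

/-- Let `V = {v_1, …, v_m}` be a linearly independent set of vectors in
`ℝ^n`, and let `L` be the spherical simplex of unit vectors `x/‖x‖` where `x` is a
nonzero nonnegative linear combination of the `v_i`.  For every compact connected
`Z ⊆ L` there is a walk `c` over `V` starting at the origin with `‖c t‖ → ∞` whose
radial limit set is exactly `Z`. -/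
theorem stmt1 (n m : ℕ) (hn : 1 ≤ n)
    (v : Fin m → EuclideanSpace ℝ (Fin n)) (hv : LinearIndependent ℝ v)
    (L : Set (EuclideanSpace ℝ (Fin n)))
    (hL : L = {y | ∃ x : EuclideanSpace ℝ (Fin n), x ≠ 0 ∧
      (∃ t : Fin m → ℝ, (∀ i, 0 ≤ t i) ∧ x = ∑ i, t i • v i) ∧ y = ‖x‖⁻¹ • x})
    (Z : Set (EuclideanSpace ℝ (Fin n)))
    (hZL : Z ⊆ L) (hZc : IsCompact Z) (hZconn : IsConnected Z) :
    ∃ c : ℝ → EuclideanSpace ℝ (Fin n), IsWalk v c ∧ c 0 = 0 ∧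
      Tendsto (fun t => ‖c t‖) atTop atTop ∧
      radialLimitSet c = Z := by
  rw [hL] at hZL
  obtain ⟨σ, π, σ_cont, π_cont, z_norm, σ_pos, π_mem, π_comb⟩ :=
    exists_barycentric_coordinates hv hZL
  have : ConnectedSpace Z := isConnected_iff_connectedSpace.1 hZconn
  have : CompactSpace Z := isCompact_iff_compactSpace.1 hZc
  obtain ⟨P, hP, hPacc⟩ := exists_seq_dist_tendsto_zero_forall_mapClusterPt Z
  have hπP : Tendsto (fun k => dist (π (P k)) (π (P (k + 1)))) atTop (nhds 0) :=
    (CompactSpace.uniformContinuous_of_continuous π_cont).tendsto_dist_comp hP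
  obtain ⟨j, hj⟩ := exists_steps_tendsto_average (fun k => π_mem (P k)) hπP
  let z : ℕ → EuclideanSpace ℝ (Fin n) := fun N => P (Nat.log 2 N)
  have z_mem (N : ℕ) : z N ∈ Z := (P _).2
  let y : ℕ → EuclideanSpace ℝ (Fin n) := fun N => (σ (z N))⁻¹ • z N
  let c := stepPath fun k => v (j k)
  have havg : Tendsto (fun N : ℕ => (N : ℝ)⁻¹ • ∑ k ∈ Finset.range N, v (j k) - y N)
      atTop (nhds 0) := by
    have h1 := ((Fintype.linearCombination ℝ v).continuous_of_finiteDimensional.tendsto 0).comp hj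
    rw [map_zero] at h1
    refine h1.congr fun N => ?_
    simp only [Function.comp_def, map_sub, map_smul, map_sum, π_comb,
      Fintype.linearCombination_apply_single, one_smul, y, z]
  have hvel : Tendsto (fun t : ℝ => (⌊t⌋₊ : ℝ)⁻¹ • c t - y ⌊t⌋₊) atTop (nhds 0) :=
    tendsto_inv_floor_smul_stepPath_sub (M := ∑ i, ‖v i‖)
      (fun k => Finset.single_le_sum (f := fun i => ‖v i‖) (fun i _ => norm_nonneg _)
        (Finset.mem_univ (j k))) havg
  obtain ⟨S, hS⟩ := hZc.exists_bound_of_continuousOn σ_cont.continuousOn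
  have σ_le (N : ℕ) : σ (z N) ≤ S := (Real.le_norm_self _).trans (hS _ (z_mem N))
  have S_pos : 0 < S := (σ_pos _ (z_mem 0)).trans_le (σ_le 0)
  have norm_y (N : ℕ) : ‖y N‖ = (σ (z N))⁻¹ := by
    rw [norm_smul, z_norm _ (z_mem N), mul_one,
      Real.norm_of_nonneg (inv_nonneg.2 (σ_pos _ (z_mem N)).le)]
  have y_ge (N : ℕ) : S⁻¹ ≤ ‖y N‖ := by
    rw [norm_y]
    exact inv_anti₀ (σ_pos _ (z_mem N)) (σ_le N)
  have normalize_y (N : ℕ) : ‖y N‖⁻¹ • y N = z N := by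
    rw [norm_y, inv_inv]
    exact smul_inv_smul₀ (σ_pos _ (z_mem N)).ne' _
  have hfloor : Tendsto (fun t : ℝ => (⌊t⌋₊ : ℝ)) atTop atTop :=
    tendsto_natCast_atTop_atTop.comp tendsto_nat_floor_atTop
  have hdir : Tendsto (fun t => ‖c t‖⁻¹ • c t - z ⌊t⌋₊) atTop (nhds 0) := by
    have h1 := hvel.norm.const_mul (2 * S)
    rw [norm_zero, mul_zero] at h1
    refine squeeze_zero_norm' ?_ h1
    filter_upwards [hfloor.eventually_gt_atTop 0] with t ht
    have hy : 0 < ‖y ⌊t⌋₊‖ := (inv_pos.2 S_pos).trans_le (y_ge _)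
    have h2 := norm_inv_norm_smul_sub_inv_norm_smul_le ((⌊t⌋₊ : ℝ)⁻¹ • c t)
      (norm_pos_iff.1 hy)
    have h3 : ‖(⌊t⌋₊ : ℝ)⁻¹ • c t‖⁻¹ • (⌊t⌋₊ : ℝ)⁻¹ • c t = ‖c t‖⁻¹ • c t := by
      rw [norm_smul, norm_inv, Real.norm_natCast, smul_smul]
      congr 1
      field_simp
    rw [normalize_y, h3] at h2
    refine h2.trans ?_
    rw [div_eq_mul_inv, mul_right_comm]
    gcongr
    exact inv_le_of_inv_le₀ S_pos (y_ge _)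
  refine ⟨c, isWalk_stepPath v j, by simp [c, stepPath], ?_, ?_⟩
  · have h1 : ∀ᶠ t in atTop, ‖(⌊t⌋₊ : ℝ)⁻¹ • c t - y ⌊t⌋₊‖ < S⁻¹ / 2 := by
      have := hvel.norm
      rw [norm_zero] at this
      exact this.eventually_lt_const (by positivity)
    refine tendsto_atTop_mono' _ ?_ (hfloor.atTop_mul_const (r := S⁻¹ / 2) (by positivity))
    filter_upwards [h1, hfloor.eventually_gt_atTop 0] with t ht hpos
    have h2 := norm_sub_norm_le (y ⌊t⌋₊) ((⌊t⌋₊ : ℝ)⁻¹ • c t)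
    rw [norm_sub_rev, norm_smul (⌊t⌋₊ : ℝ)⁻¹, norm_inv, Real.norm_natCast] at h2
    have h3 : S⁻¹ / 2 ≤ (⌊t⌋₊ : ℝ)⁻¹ * ‖c t‖ := by linarith [y_ge ⌊t⌋₊]
    rwa [← div_eq_inv_mul, le_div_iff₀' hpos] at h3
  · refine radialLimitSet_eq_of_tendsto hZc.isClosed z_mem hdir fun q hq => ?_
    obtain ⟨ψ, hψ, hψq⟩ := (hPacc ⟨q, hq⟩).tendsto_subseq
    refine ⟨fun k => 2 ^ ψ k, (tendsto_pow_atTop_atTop_of_one_lt one_lt_two).comp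
      hψ.tendsto_atTop, ?_⟩
    simp only [z, Nat.log_pow one_lt_two]
    exact (continuous_subtype_val.tendsto _).comp hψq
end

section
/- Let n ≥ 1, let L ⊂ ℝ^n be the set of unit vectors with all coordinates nonnegative, and let W = {e_1,…,e_n}. Let γ : [0,a] → L be any continuous path (a > 0) and let ε > 0. Then for every point x ∈ L with angle(x, γ(0)) < ε there exists a positive integer a' and a W-directed path γ' : [0,a'] → L with γ'(0) = x such that: (i) every point of the image of γ is within angle ε of some point of the image of γ' and every point of the image of γ' is within angle ε of some point of the image of γ (i.e. the Hausdorff distance between the images, in the angular metric, is at most ε); and (ii) angle(γ'(a'), γ(a)) < ε/2. -/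
open InnerProductGeometry

/-- A `W`-directed path `γ : [0, a] → sphere` for `W` a set of unit vectors:
on each interval `[k-1, k]` the path is either constant or an injective path
traversing (monotonically, starting from `γ (k-1)`) an initial subsegment of the
spherical geodesic from `γ (k-1)` toward some `w ∈ W`. -/
def IsDirectedPath {n : ℕ} (W : Set (EuclideanSpace ℝ (Fin n))) (a : ℕ)
    (γ : ℝ → EuclideanSpace ℝ (Fin n)) : Prop :=
  ContinuousOn γ (Set.Icc 0 (a : ℝ)) ∧
  ∀ k : ℕ, 1 ≤ k → k ≤ a →
    (∀ t ∈ Set.Icc ((k : ℝ) - 1) (k : ℝ), γ t = γ ((k : ℝ) - 1)) ∨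
    (Set.InjOn γ (Set.Icc ((k : ℝ) - 1) (k : ℝ)) ∧
      ∃ w ∈ W, ∃ s : ℝ → ℝ,
        ContinuousOn s (Set.Icc ((k : ℝ) - 1) (k : ℝ)) ∧
        MonotoneOn s (Set.Icc ((k : ℝ) - 1) (k : ℝ)) ∧
        s ((k : ℝ) - 1) = 0 ∧
        ∀ t ∈ Set.Icc ((k : ℝ) - 1) (k : ℝ), s t ∈ Set.Icc (0 : ℝ) 1 ∧
          γ t = ‖(1 - s t) • γ ((k : ℝ) - 1) + s t • w‖⁻¹ •
            ((1 - s t) • γ ((k : ℝ) - 1) + s t • w))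

/-- Moving `p` in the direction of a standard basis vector, the whole segment lying in `U`. -/
def AxisStep {n : ℕ} (U : Set (EuclideanSpace ℝ (Fin n))) (p q : EuclideanSpace ℝ (Fin n)) : Prop :=
  ∃ i : Fin n, ∃ c : ℝ, 0 ≤ c ∧ q = p + c • EuclideanSpace.single i 1 ∧ segment ℝ p q ⊆ U

/-- A sequence of axis steps in `U` starting at `x`, being at `q` at some time `N`, and visiting
all points of `A` up to time `N`. -/
def AxisChain {n : ℕ} (U : Set (EuclideanSpace ℝ (Fin n))) (x q : EuclideanSpace ℝ (Fin n))
    (A : Set (EuclideanSpace ℝ (Fin n))) : Prop :=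
  ∃ (N : ℕ) (p : ℕ → EuclideanSpace ℝ (Fin n)), 0 < N ∧ p 0 = x ∧ p N = q ∧
    (∀ k, AxisStep U (p k) (p (k + 1))) ∧ ∀ b ∈ A, ∃ k ≤ N, p k = b

section AxisSteps

variable {n : ℕ} {U : Set (EuclideanSpace ℝ (Fin n))}

lemma AxisStep.right_mem {p q : EuclideanSpace ℝ (Fin n)} (h : AxisStep U p q) : q ∈ U := by
  obtain ⟨i, c, -, -, hU⟩ := h
  exact hU (right_mem_segment ℝ p q)

lemma axisStep_self (hn : 1 ≤ n) {p : EuclideanSpace ℝ (Fin n)} (hp : p ∈ U) : AxisStep U p p :=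
  ⟨⟨0, hn⟩, 0, le_rfl, by simp, by simpa using hp⟩

lemma axisChain_refl (hn : 1 ≤ n) {x : EuclideanSpace ℝ (Fin n)} (hx : x ∈ U) :
    AxisChain U x x {x} :=
  ⟨1, fun _ => x, one_pos, rfl, rfl, fun _ => axisStep_self hn hx,
    fun b hb => ⟨0, by simp, hb.symm⟩⟩

lemma AxisChain.step (hn : 1 ≤ n) {x q q' : EuclideanSpace ℝ (Fin n)}
    {A : Set (EuclideanSpace ℝ (Fin n))} (h : AxisChain U x q A) (hq : AxisStep U q q') :
    AxisChain U x q' (insert q' A) := by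
  obtain ⟨N, p, hN, h0, hpN, hp, hA⟩ := h
  refine ⟨N + 1, fun k => if k ≤ N then p k else q', by omega, by simp [h0], by simp, ?_, ?_⟩
  · intro k
    rcases lt_trichotomy k N with hk | rfl | hk
    · simpa [hk.le, Nat.succ_le_of_lt hk] using hp k
    · simpa [hpN] using hq
    · simpa [not_le.2 hk, not_le.2 (hk.trans (Nat.lt_succ_self k))]
        using axisStep_self hn hq.right_mem
  · rintro b (rfl | hb)
    · exact ⟨N + 1, le_rfl, by simp⟩
    · obtain ⟨k, hk, hkb⟩ := hA b hb
      exact ⟨k, by omega, by simp [hk, hkb]⟩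

lemma AxisChain.mono {x q : EuclideanSpace ℝ (Fin n)} {A B : Set (EuclideanSpace ℝ (Fin n))}
    (h : AxisChain U x q A) (hBA : B ⊆ A) : AxisChain U x q B := by
  obtain ⟨N, p, hN, h0, hpN, hp, hA⟩ := h
  exact ⟨N, p, hN, h0, hpN, hp, fun b hb => hA b (hBA hb)⟩

lemma AxisChain.trans (hn : 1 ≤ n) {x q q' : EuclideanSpace ℝ (Fin n)}
    {A : Set (EuclideanSpace ℝ (Fin n))} (h : AxisChain U x q A) (hqA : q ∈ A)
    (hq : Relation.ReflTransGen (AxisStep U) q q') :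
    AxisChain U x q' (insert q' A) := by
  induction hq with
  | refl => rwa [Set.insert_eq_of_mem hqA]
  | tail _ hstep ih =>
    exact (ih.step hn hstep).mono (Set.insert_subset_insert (Set.subset_insert _ _))

lemma norm_sum_single_le (y : EuclideanSpace ℝ (Fin n)) (s : Finset (Fin n)) :
    ‖∑ i ∈ s, y i • EuclideanSpace.single i (1 : ℝ)‖ ≤ ‖y‖ := by
  classical
  refine le_of_sq_le_sq ?_ (norm_nonneg _)
  rw [EuclideanSpace.norm_sq_eq, EuclideanSpace.norm_sq_eq]
  refine Finset.sum_le_sum fun j _ => ?_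
  have : (∑ i ∈ s, y i • EuclideanSpace.single i (1 : ℝ)) j = if j ∈ s then y j else 0 := by
    simp [Pi.single_apply]
  rw [this]
  split_ifs
  · rfl
  · simpa using sq_nonneg (y j)

lemma sum_univ_single (y : EuclideanSpace ℝ (Fin n)) :
    ∑ i, y i • EuclideanSpace.single i (1 : ℝ) = y := by
  ext j
  simp [Pi.single_apply]

lemma reflTransGen_axisStep_of_ball_subset {y r : EuclideanSpace ℝ (Fin n)} (hy : ∀ i, 0 ≤ y i)
    {δ : ℝ} (hyδ : ‖y‖ < δ) (hU : Metric.ball r δ ⊆ U) :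
    Relation.ReflTransGen (AxisStep U) r (r + y) := by
  classical
  have key (s : Finset (Fin n)) : Relation.ReflTransGen (AxisStep U) r
      (r + ∑ i ∈ s, y i • EuclideanSpace.single i (1 : ℝ)) := by
    induction s using Finset.induction_on with
    | empty => simpa using Relation.ReflTransGen.refl
    | insert i s hi ih =>
      have hball (t : Finset (Fin n)) :
          r + ∑ i ∈ t, y i • EuclideanSpace.single i (1 : ℝ) ∈ Metric.ball r δ := by
        simpa [Metric.mem_ball, dist_eq_norm] using (norm_sum_single_le y t).trans_lt hyδ
      refine ih.tail ⟨i, y i, hy i, ?_, ?_⟩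
      · rw [Finset.sum_insert hi]
        abel
      · exact ((convex_ball r δ).segment_subset (hball s) (hball _)).trans hU
  simpa [sum_univ_single] using key Finset.univ

lemma reflTransGen_axisStep_of_segment_subset (hUo : IsOpen U) {q y : EuclideanSpace ℝ (Fin n)}
    (hy : ∀ i, 0 ≤ y i) (hseg : segment ℝ q (q + y) ⊆ U) :
    Relation.ReflTransGen (AxisStep U) q (q + y) := by
  have hcomp : IsCompact (segment ℝ q (q + y)) := by
    rw [segment_eq_image_lineMap]
    exact isCompact_Icc.image (AffineMap.lineMap_continuous)
  obtain ⟨δ, hδ, hthick⟩ := hcomp.exists_thickening_subset_open hUo hseg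
  obtain ⟨N, hN⟩ := exists_nat_gt (‖y‖ / δ)
  have hN0 : (0 : ℝ) < N := (div_nonneg (norm_nonneg y) hδ.le).trans_lt hN
  have hsmall : ‖(N : ℝ)⁻¹ • y‖ < δ := by
    rw [norm_smul, norm_inv, Real.norm_of_nonneg hN0.le, inv_mul_lt_iff₀ hN0]
    rwa [div_lt_iff₀ hδ] at hN
  have key : ∀ k ≤ N, Relation.ReflTransGen (AxisStep U) q (q + ((k : ℝ) / N) • y) := by
    intro k
    induction k with
    | zero => intro _; simpa using Relation.ReflTransGen.refl
    | succ k ih =>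
      intro hk
      have hmem : q + ((k : ℝ) / N) • y ∈ segment ℝ q (q + y) := by
        rw [segment_eq_image']
        have : (k : ℝ) ≤ N := by exact_mod_cast (Nat.le_succ k).trans hk
        exact ⟨k / N, ⟨by positivity, by rwa [div_le_one hN0]⟩, by simp⟩
      have := reflTransGen_axisStep_of_ball_subset (y := (N : ℝ)⁻¹ • y)
        (fun i => by simpa using mul_nonneg (inv_nonneg.2 hN0.le) (hy i)) hsmall
        ((Metric.ball_subset_thickening hmem δ).trans hthick)
      convert (ih (by omega)).trans this using 1
      rw [add_assoc, ← add_smul]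
      congr 2
      push_cast
      field_simp
  simpa [hN0.ne'] using key N le_rfl

end AxisSteps

section Angle

variable {n : ℕ}

lemma nonneg_add_ne_zero {q y : EuclideanSpace ℝ (Fin n)} (hq : ∀ i, 0 ≤ q i) (hq0 : q ≠ 0)
    (hy : ∀ i, 0 ≤ y i) : q + y ≠ 0 := by
  intro h
  refine hq0 (PiLp.ext fun i => ?_)
  have h1 : q i + y i = 0 := by simpa using congrArg (fun v => v i) h
  have h2 := hq i
  have h3 := hy i
  simp only [PiLp.zero_apply]
  linarith

lemma angle_add_smul_le {V : Type*} [NormedAddCommGroup V] [InnerProductSpace ℝ V] {q y : V}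
    {s : ℝ} (hs : 0 ≤ s) (h0 : q + s • y ≠ 0) : angle (q + s • y) y ≤ angle q y := by
  have hmem : q + s • y ∈ Submodule.span NNReal {q, y} := by
    rw [Submodule.mem_span_pair]
    exact ⟨1, s.toNNReal, by simp [NNReal.smul_def, hs]⟩
  have := angle_eq_angle_add_add_angle_add_of_mem_span h0 hmem
  linarith [angle_nonneg q (q + s • y)]

lemma exists_angle_add_smul_lt {V : Type*} [NormedAddCommGroup V] [InnerProductSpace ℝ V] (q : V)
    {y : V} (hy : y ≠ 0) {η : ℝ} (hη : 0 < η) : ∃ T : ℝ, 0 < T ∧ angle (q + T • y) y < η := by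
  have hc : ContinuousAt (fun u : ℝ => angle (u • q + y) y) 0 := by
    refine ContinuousAt.comp (f := fun u : ℝ => (u • q + y, y))
      (g := fun z : V × V => angle z.1 z.2) ?_ (by fun_prop)
    exact continuousAt_angle (by simpa using hy) hy
  have hlt : ∀ᶠ u in nhdsWithin (0 : ℝ) (Set.Ioi 0), angle (u • q + y) y < η :=
    (hc.eventually_lt_const (by simpa [angle_self hy] using hη)).filter_mono nhdsWithin_le_nhds
  obtain ⟨u, hu, hu0⟩ := (hlt.and self_mem_nhdsWithin).exists
  have hu0 : 0 < u := hu0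
  refine ⟨u⁻¹, inv_pos.2 hu0, ?_⟩
  rw [← angle_smul_left_of_pos _ _ hu0]
  simpa [smul_smul, hu0.ne'] using hu

/-- The open cone of directions at angle less than `ε` from a nonzero element of `A`. -/
def angularThickening (ε : ℝ) (A : Set (EuclideanSpace ℝ (Fin n))) :
    Set (EuclideanSpace ℝ (Fin n)) :=
  {p | p ≠ 0 ∧ ∃ y ∈ A, y ≠ 0 ∧ angle p y < ε}

lemma isOpen_angularThickening (ε : ℝ) (A : Set (EuclideanSpace ℝ (Fin n))) :
    IsOpen (angularThickening ε A) := by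
  rw [isOpen_iff_mem_nhds]
  rintro p ⟨hp, y, hyA, hy, hpy⟩
  have hc : ContinuousAt (fun u => angle u y) p :=
    ContinuousAt.comp (f := fun u : EuclideanSpace ℝ (Fin n) => (u, y))
      (g := fun z : EuclideanSpace ℝ (Fin n) × EuclideanSpace ℝ (Fin n) => angle z.1 z.2)
      (continuousAt_angle hp hy) (by fun_prop)
  filter_upwards [hc.eventually_lt_const hpy, isOpen_ne.mem_nhds hp] with u hu hu0
  exact ⟨hu0, y, hyA, hy, hu⟩

/-- From a nonnegative `q` at angle less than `ε` from `y`, axis steps lead arbitrarily close to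
the direction of `y` without ever leaving the `ε`-neighbourhood of `y`. -/
lemma exists_reflTransGen_angle_lt {ε η : ℝ} (hη : 0 < η) {A : Set (EuclideanSpace ℝ (Fin n))}
    {q y : EuclideanSpace ℝ (Fin n)} (hq : ∀ i, 0 ≤ q i) (hq0 : q ≠ 0) (hy : ∀ i, 0 ≤ y i)
    (hy0 : y ≠ 0) (hyA : y ∈ A) (hqy : angle q y < ε) :
    ∃ q', (∀ i, 0 ≤ q' i) ∧ q' ≠ 0 ∧ angle q' y < η ∧
      Relation.ReflTransGen (AxisStep (angularThickening ε A)) q q' := by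
  obtain ⟨T, hT, hTη⟩ := exists_angle_add_smul_lt q hy0 hη
  have hsmul {s : ℝ} (hs : 0 ≤ s) (i : Fin n) : 0 ≤ (s • y) i := by
    simpa using mul_nonneg hs (hy i)
  refine ⟨q + T • y, fun i => by simpa using add_nonneg (hq i) (hsmul hT.le i),
    nonneg_add_ne_zero hq hq0 (hsmul hT.le), hTη,
    reflTransGen_axisStep_of_segment_subset (isOpen_angularThickening ε A) (hsmul hT.le) ?_⟩
  rw [segment_eq_image']
  rintro _ ⟨θ, hθ, rfl⟩
  have hs : 0 ≤ θ * T := mul_nonneg hθ.1 hT.le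
  have h0 : q + (θ * T) • y ≠ 0 := nonneg_add_ne_zero hq hq0 (hsmul hs)
  have : q + θ • (q + T • y - q) = q + (θ * T) • y := by simp [smul_smul]
  simp only [this]
  exact ⟨h0, y, hyA, hy0, (angle_add_smul_le hs h0).trans_lt hqy⟩

lemma exists_pos_forall_angle_lt {a : ℝ} {γ : ℝ → EuclideanSpace ℝ (Fin n)}
    (hγc : ContinuousOn γ (Set.Icc 0 a)) (hγ0 : ∀ t ∈ Set.Icc 0 a, γ t ≠ 0) {η : ℝ} (hη : 0 < η) :
    ∃ δ > 0, ∀ s ∈ Set.Icc 0 a, ∀ t ∈ Set.Icc 0 a, dist s t < δ → angle (γ s) (γ t) < η := by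
  have hc : ContinuousOn (fun z : ℝ × ℝ => angle (γ z.1) (γ z.2))
      (Set.Icc 0 a ×ˢ Set.Icc 0 a) := by
    intro z hz
    have hpair : ContinuousWithinAt (fun z : ℝ × ℝ => (γ z.1, γ z.2))
        (Set.Icc 0 a ×ˢ Set.Icc 0 a) z :=
      ((hγc z.1 hz.1).comp continuousWithinAt_fst fun _ h => h.1).prodMk
        ((hγc z.2 hz.2).comp continuousWithinAt_snd fun _ h => h.2)
    exact (continuousAt_angle (x := (γ z.1, γ z.2)) (hγ0 _ hz.1) (hγ0 _ hz.2)
      ).comp_continuousWithinAt (f := fun z : ℝ × ℝ => (γ z.1, γ z.2)) hpair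
  have huc := (isCompact_Icc.prod isCompact_Icc).uniformContinuousOn_of_continuous hc
  obtain ⟨δ, hδ, h⟩ := Metric.uniformContinuousOn_iff.1 huc η hη
  refine ⟨δ, hδ, fun s hs t ht hst => ?_⟩
  have := h (s, s) ⟨hs, hs⟩ (s, t) ⟨hs, ht⟩ (by simpa [Prod.dist_eq, hδ] using hst)
  simpa [angle_self (hγ0 s hs), Real.dist_eq, abs_of_nonneg (angle_nonneg _ _)] using this

/-- A chain of axis steps that follows the directions of `γ`. -/
lemma exists_axisChain_tracking (hn : 1 ≤ n) {a : ℝ} (ha : 0 < a)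
    {γ : ℝ → EuclideanSpace ℝ (Fin n)} (hγc : ContinuousOn γ (Set.Icc 0 a))
    (hγ0 : ∀ t ∈ Set.Icc 0 a, γ t ≠ 0) (hγpos : ∀ t ∈ Set.Icc 0 a, ∀ i, 0 ≤ γ t i)
    {ε : ℝ} (hε : 0 < ε) {x : EuclideanSpace ℝ (Fin n)} (hx0 : x ≠ 0) (hx : ∀ i, 0 ≤ x i)
    (hxγ : angle x (γ 0) < ε) :
    ∃ q A, AxisChain (angularThickening ε (γ '' Set.Icc 0 a)) x q A ∧
      angle q (γ a) < ε / 2 ∧ ∀ t ∈ Set.Icc 0 a, ∃ b ∈ A, angle (γ t) b ≤ ε := by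
  obtain ⟨δ, hδ, hunif⟩ := exists_pos_forall_angle_lt hγc hγ0 (half_pos hε)
  obtain ⟨m, hm⟩ := exists_nat_gt (a / δ)
  have hm0 : (0 : ℝ) < m := (div_pos ha hδ).trans hm
  have hamδ : a / m < δ := by
    rw [div_lt_iff₀ hm0]
    rwa [div_lt_iff₀ hδ, mul_comm] at hm
  have key : ∀ j ≤ m, ∃ q A, AxisChain (angularThickening ε (γ '' Set.Icc 0 a)) x q A ∧ q ∈ A ∧
      (∀ i, 0 ≤ q i) ∧ q ≠ 0 ∧ angle q (γ (j * (a / m))) < ε / 2 ∧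
      ∀ t ∈ Set.Icc 0 (j * (a / m)), ∃ b ∈ A, angle (γ t) b ≤ ε := by
    intro j
    induction j with
    | zero =>
      intro _
      have h0 : (0 : ℝ) ∈ Set.Icc 0 a := ⟨le_rfl, ha.le⟩
      have hxU : x ∈ angularThickening ε (γ '' Set.Icc 0 a) :=
        ⟨hx0, γ 0, ⟨0, h0, rfl⟩, hγ0 0 h0, hxγ⟩
      obtain ⟨q, hq, hq0, hqγ, hstep⟩ := exists_reflTransGen_angle_lt (half_pos hε) hx hx0
        (hγpos 0 h0) (hγ0 0 h0) (Set.mem_image_of_mem γ h0) hxγ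
      refine ⟨q, {q, x}, (axisChain_refl hn hxU).trans hn rfl hstep, by simp, hq, hq0,
        by simpa using hqγ, fun t ht => ⟨q, by simp, ?_⟩⟩
      have : t = 0 := by simpa using ht
      rw [this, angle_comm]
      linarith
    | succ j ih =>
      intro hj
      obtain ⟨q, A, hchain, hqA, hq, hq0, hqγ, hvisit⟩ := ih (by omega)
      have ham : 0 < a / m := div_pos ha hm0
      have hle : ((j + 1 : ℕ) : ℝ) * (a / m) ≤ a := by
        have : ((j + 1 : ℕ) : ℝ) ≤ m := by exact_mod_cast hj
        calc ((j + 1 : ℕ) : ℝ) * (a / m) ≤ m * (a / m) := by gcongr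
          _ = a := by field_simp
      have hsucc : ((j + 1 : ℕ) : ℝ) * (a / m) = j * (a / m) + a / m := by push_cast; ring
      have hj0 : 0 ≤ (j : ℝ) * (a / m) := by positivity
      have hmem : (j : ℝ) * (a / m) ∈ Set.Icc 0 a := ⟨hj0, by linarith⟩
      have hmem' : ((j + 1 : ℕ) : ℝ) * (a / m) ∈ Set.Icc 0 a := ⟨by linarith, hle⟩
      have hnear : ∀ t ∈ Set.Icc ((j : ℝ) * (a / m)) (((j + 1 : ℕ) : ℝ) * (a / m)),
          angle q (γ t) < ε := by
        intro t ht
        have h1 := hunif _ hmem t ⟨hj0.trans ht.1, ht.2.trans hle⟩ (by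
          rw [dist_comm, Real.dist_eq, abs_of_nonneg (by linarith [ht.1])]
          linarith [ht.2])
        linarith [angle_le_angle_add_angle q (γ (j * (a / m))) (γ t)]
      obtain ⟨q', hq', hq'0, hq'γ, hstep⟩ := exists_reflTransGen_angle_lt (half_pos hε) hq hq0
        (hγpos _ hmem') (hγ0 _ hmem') (Set.mem_image_of_mem γ hmem')
        (hnear _ ⟨by linarith, le_rfl⟩)
      refine ⟨q', insert q' A, hchain.trans hn hqA hstep, by simp, hq', hq'0, hq'γ, fun t ht => ?_⟩
      rcases le_total t (j * (a / m)) with htj | htj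
      · obtain ⟨b, hb, hbt⟩ := hvisit t ⟨ht.1, htj⟩
        exact ⟨b, Set.mem_insert_of_mem _ hb, hbt⟩
      · exact ⟨q, Set.mem_insert_of_mem _ hqA, by
          rw [angle_comm]; exact (hnear t ⟨htj, ht.2⟩).le⟩
  obtain ⟨q, A, hchain, -, -, -, hqγ, hvisit⟩ := key m le_rfl
  have hma : (m : ℝ) * (a / m) = a := by field_simp
  rw [hma] at hqγ hvisit
  exact ⟨q, A, hchain, hqγ, hvisit⟩

end Angle

section Path

variable {n : ℕ}

/-- The piecewise linear path through `p 0, …, p N`. -/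
noncomputable def polygonalPath {V : Type*} [AddCommGroup V] [Module ℝ V] (p : ℕ → V) (N : ℕ)
    (t : ℝ) : V :=
  p 0 + ∑ k ∈ Finset.range N, max 0 (min 1 (t - k)) • (p (k + 1) - p k)

lemma continuous_polygonalPath (p : ℕ → EuclideanSpace ℝ (Fin n)) (N : ℕ) :
    Continuous (polygonalPath p N) := by
  unfold polygonalPath
  fun_prop

lemma polygonalPath_eq {V : Type*} [AddCommGroup V] [Module ℝ V] (p : ℕ → V) {N k : ℕ}
    (hk : k < N) {t : ℝ} (ht : t ∈ Set.Icc (k : ℝ) (k + 1)) :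
    polygonalPath p N t = p k + (t - k) • (p (k + 1) - p k) := by
  have hlow : ∀ i ∈ Finset.range k,
      max 0 (min 1 (t - i)) • (p (i + 1) - p i) = p (i + 1) - p i := by
    intro i hi
    have : (i : ℝ) + 1 ≤ k := by exact_mod_cast Finset.mem_range.1 hi
    rw [min_eq_left (by linarith [ht.1]), max_eq_right zero_le_one, one_smul]
  have hhigh : ∀ i ∈ Finset.range N, i ∉ Finset.range (k + 1) →
      max 0 (min 1 (t - i)) • (p (i + 1) - p i) = 0 := by
    intro i _ hi
    have : (k : ℝ) + 1 ≤ i := by exact_mod_cast not_lt.1 (fun h => hi (Finset.mem_range.2 h))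
    rw [max_eq_left ((min_le_right _ _).trans (by linarith [ht.2])), zero_smul]
  rw [polygonalPath, ← Finset.sum_subset (Finset.range_subset_range.2 hk) hhigh,
    Finset.sum_range_succ, Finset.sum_congr rfl hlow, Finset.sum_range_sub,
    min_eq_right (by linarith [ht.2]), max_eq_right (by linarith [ht.1])]
  abel

lemma polygonalPath_natCast {V : Type*} [AddCommGroup V] [Module ℝ V] (p : ℕ → V) {N k : ℕ}
    (hN : 0 < N) (hk : k ≤ N) : polygonalPath p N k = p k := by
  rcases hk.lt_or_eq with hk | rfl
  · simpa using polygonalPath_eq p hk (t := k) ⟨le_rfl, by simp⟩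
  · obtain ⟨j, rfl⟩ := Nat.exists_eq_add_of_lt hN
    simpa using polygonalPath_eq p (Nat.lt_succ_self (0 + j)) (t := ((0 + j + 1 : ℕ) : ℝ))
      ⟨by simp, by simp⟩

lemma exists_mem_segment_polygonalPath {V : Type*} [AddCommGroup V] [Module ℝ V] (p : ℕ → V)
    {N : ℕ} (hN : 0 < N) {t : ℝ} (ht : t ∈ Set.Icc 0 (N : ℝ)) :
    ∃ k, polygonalPath p N t ∈ segment ℝ (p k) (p (k + 1)) := by
  obtain ⟨k, hk, hkt⟩ : ∃ k < N, t ∈ Set.Icc (k : ℝ) (k + 1) := by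
    rcases ht.2.lt_or_eq with h | rfl
    · exact ⟨⌊t⌋₊, (Nat.floor_lt ht.1).2 h, Nat.floor_le ht.1, (Nat.lt_floor_add_one t).le⟩
    · obtain ⟨j, rfl⟩ := Nat.exists_eq_add_of_lt hN
      exact ⟨j, by omega, by simp, by simp⟩
  refine ⟨k, ?_⟩
  rw [polygonalPath_eq p hk hkt, segment_eq_image']
  exact ⟨t - k, ⟨by linarith [hkt.1], by linarith [hkt.2]⟩, rfl⟩

lemma normalize_convex_combination {V : Type*} [NormedAddCommGroup V] [NormedSpace ℝ V] {p : V}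
    (hp : p ≠ 0) (e : V) {u : ℝ} (hu : 0 ≤ u) :
    NormedSpace.normalize ((1 - u / (‖p‖ + u)) • NormedSpace.normalize p + (u / (‖p‖ + u)) • e)
      = NormedSpace.normalize (p + u • e) := by
  have hpos : 0 < ‖p‖ := norm_pos_iff.2 hp
  have hsum : 0 < ‖p‖ + u := by linarith
  have : (1 - u / (‖p‖ + u)) • NormedSpace.normalize p + (u / (‖p‖ + u)) • e
      = (‖p‖ + u)⁻¹ • (p + u • e) := by
    rw [NormedSpace.normalize, smul_smul, smul_add, smul_smul]
    congr 2 <;> field_simp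
    ring
  rw [this, NormedSpace.normalize_smul_of_pos (inv_pos.2 hsum)]

lemma injective_normalize_add_smul {V : Type*} [NormedAddCommGroup V] [NormedSpace ℝ V] {p e : V}
    (he : e ≠ 0) (hpe : ∀ r : ℝ, p ≠ r • e) :
    Function.Injective fun u : ℝ => NormedSpace.normalize (p + u • e) := by
  intro u v huv
  have hne (w : ℝ) : p + w • e ≠ 0 := fun h => hpe (-w) (by
    rw [neg_smul]; exact eq_neg_of_add_eq_zero_left h)
  simp only [NormedSpace.normalize] at huv
  set α := ‖p + u • e‖⁻¹
  set β := ‖p + v • e‖⁻¹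
  have hα : α ≠ 0 := inv_ne_zero (norm_ne_zero_iff.2 (hne u))
  have hlin : (α - β) • p = (β * v - α * u) • e := by
    rw [smul_add, smul_add, smul_smul, smul_smul] at huv
    rw [sub_smul, sub_smul, sub_eq_sub_iff_add_eq_add, huv]
    abel
  have hαβ : α = β := by
    by_contra h
    have h' : α - β ≠ 0 := sub_ne_zero.2 h
    refine hpe ((α - β)⁻¹ * (β * v - α * u)) ?_
    rw [← smul_smul, ← hlin, smul_smul, inv_mul_cancel₀ h', one_smul]
  rw [hαβ, sub_self, zero_smul, ← mul_sub] at hlin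
  rcases smul_eq_zero.1 hlin.symm with h | h
  · rcases mul_eq_zero.1 h with h | h
    · exact absurd (hαβ.trans h) hα
    · linarith
  · exact absurd h he

lemma AxisStep.nonneg {U : Set (EuclideanSpace ℝ (Fin n))} {p q : EuclideanSpace ℝ (Fin n)}
    (h : AxisStep U p q) (hp : ∀ i, 0 ≤ p i) (i : Fin n) : 0 ≤ q i := by
  obtain ⟨j, c, hc, rfl, -⟩ := h
  have : 0 ≤ if i = j then c else 0 := by split_ifs <;> simp [hc]
  simpa [Pi.single_apply] using add_nonneg (hp i) this

lemma isDirectedPath_normalize_polygonalPath {U : Set (EuclideanSpace ℝ (Fin n))}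
    (hU : (0 : EuclideanSpace ℝ (Fin n)) ∉ U) {p : ℕ → EuclideanSpace ℝ (Fin n)} {N : ℕ}
    (hN : 0 < N) (hp : ∀ k, AxisStep U (p k) (p (k + 1))) (hpos : ∀ k i, 0 ≤ p k i) :
    IsDirectedPath (Set.range fun i : Fin n => EuclideanSpace.single i (1 : ℝ)) N
      fun t => NormedSpace.normalize (polygonalPath p N t) := by
  have hne {t : ℝ} (ht : t ∈ Set.Icc 0 (N : ℝ)) : polygonalPath p N t ≠ 0 := by
    obtain ⟨k, hk⟩ := exists_mem_segment_polygonalPath p hN ht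
    obtain ⟨_, _, _, _, hseg⟩ := hp k
    exact fun h => hU (h ▸ hseg hk)
  refine ⟨?_, ?_⟩
  · have hc := (continuous_polygonalPath p N).continuousOn (s := Set.Icc 0 (N : ℝ))
    exact (hc.norm.inv₀ fun t ht => norm_ne_zero_iff.2 (hne ht)).smul hc
  rintro k hk1 hkN
  obtain ⟨j, rfl⟩ := Nat.exists_eq_add_of_le' hk1
  have hcast : ((j + 1 : ℕ) : ℝ) - 1 = j := by push_cast; ring
  rw [hcast]
  push_cast
  obtain ⟨i, c, hc, hstep, hseg⟩ := hp j
  set e : EuclideanSpace ℝ (Fin n) := EuclideanSpace.single i 1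
  have he : e ≠ 0 := by simp [e]
  have hpj : p j ≠ 0 := fun h => hU (h ▸ hseg (left_mem_segment ℝ _ _))
  have hval {t : ℝ} (ht : t ∈ Set.Icc (j : ℝ) (j + 1)) :
      polygonalPath p N t = p j + ((t - j) * c) • e := by
    rw [polygonalPath_eq p hkN ht, hstep, add_sub_cancel_left, smul_smul]
  have hval0 : polygonalPath p N j = p j := polygonalPath_natCast p hN (by omega)
  rw [hval0]
  have hu {t : ℝ} (ht : t ∈ Set.Icc (j : ℝ) (j + 1)) : 0 ≤ (t - j) * c :=
    mul_nonneg (by linarith [ht.1]) hc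
  by_cases hconst : c = 0 ∨ ∃ r : ℝ, p j = r • e
  · left
    intro t ht
    rw [hval ht]
    rcases hconst with rfl | ⟨r, hr⟩
    · simp
    · have hr0 : 0 < r := by
        refine lt_of_le_of_ne ?_ fun h => hpj (by rw [hr, ← h, zero_smul])
        simpa [hr, e] using hpos j i
      rw [hr, ← add_smul, NormedSpace.normalize_smul_of_pos hr0,
        NormedSpace.normalize_smul_of_pos (add_pos_of_pos_of_nonneg hr0 (hu ht))]
  · right
    push Not at hconst
    obtain ⟨hc0, hpe⟩ := hconst
    have hpn : 0 < ‖p j‖ := norm_pos_iff.2 hpj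
    refine ⟨?_, e, ⟨i, rfl⟩, fun t => (t - j) * c / (‖p j‖ + (t - j) * c), ?_, ?_, by simp, ?_⟩
    · intro t ht t' ht' htt
      simp only [hval ht, hval ht'] at htt
      have := injective_normalize_add_smul he hpe htt
      linarith [mul_right_cancel₀ hc0 this]
    · refine ContinuousOn.div (by fun_prop) (by fun_prop) fun t ht => ?_
      linarith [hu ht]
    · intro t ht t' ht' htt
      have hle : (t - j) * c ≤ (t' - j) * c := by gcongr
      have h1 := hu ht
      have h2 := hu ht'
      simp only
      rw [div_le_div_iff₀ (by linarith) (by linarith)]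
      nlinarith
    · intro t ht
      have h1 := hu ht
      refine ⟨⟨by positivity, ?_⟩, ?_⟩
      · rw [div_le_one (by linarith)]
        linarith
      · rw [hval ht]
        exact (normalize_convex_combination hpj e h1).symm

end Path

/-- Let `L` be the set of nonnegative unit vectors in `ℝ^n` and
`W = {e_1, …, e_n}`.  Any continuous path `γ : [0, a] → L` can be approximated, within
Hausdorff distance `ε` in the angular metric, by a `W`-directed path `γ'` starting at any
prescribed point `x ∈ L` with `angle x (γ 0) < ε`, and ending within angle `ε/2` of
`γ a`. -/
theorem stmt3 (n : ℕ) (hn : 1 ≤ n)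
    (L : Set (EuclideanSpace ℝ (Fin n)))
    (hL : L = {y : EuclideanSpace ℝ (Fin n) | ‖y‖ = 1 ∧ ∀ i, 0 ≤ y i})
    (W : Set (EuclideanSpace ℝ (Fin n)))
    (hW : W = Set.range (fun i : Fin n => EuclideanSpace.single i (1 : ℝ)))
    (a : ℝ) (ha : 0 < a)
    (γ : ℝ → EuclideanSpace ℝ (Fin n))
    (hγc : ContinuousOn γ (Set.Icc 0 a))
    (hγL : ∀ t ∈ Set.Icc (0 : ℝ) a, γ t ∈ L)
    (ε : ℝ) (hε : 0 < ε)
    (x : EuclideanSpace ℝ (Fin n)) (hx : x ∈ L)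
    (hxγ : angle x (γ 0) < ε) :
    ∃ a' : ℕ, 0 < a' ∧ ∃ γ' : ℝ → EuclideanSpace ℝ (Fin n),
      IsDirectedPath W a' γ' ∧
      γ' 0 = x ∧
      (∀ t ∈ Set.Icc (0 : ℝ) (a' : ℝ), γ' t ∈ L) ∧
      (∀ t ∈ Set.Icc (0 : ℝ) a, ∃ t' ∈ Set.Icc (0 : ℝ) (a' : ℝ),
        angle (γ t) (γ' t') ≤ ε) ∧
      (∀ t' ∈ Set.Icc (0 : ℝ) (a' : ℝ), ∃ t ∈ Set.Icc (0 : ℝ) a,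
        angle (γ t) (γ' t') ≤ ε) ∧
      angle (γ' (a' : ℝ)) (γ a) < ε / 2 := by
  subst hL hW
  have hγ0 : ∀ t ∈ Set.Icc 0 a, γ t ≠ 0 := fun t ht => norm_ne_zero_iff.1 (by simp [(hγL t ht).1])
  have hx0 : x ≠ 0 := norm_ne_zero_iff.1 (by simp [hx.1])
  obtain ⟨q, A, ⟨N, p, hN, hp0, hpN, hp, hA⟩, hqγ, hvisit⟩ := exists_axisChain_tracking hn ha hγc
    hγ0 (fun t ht => (hγL t ht).2) hε hx0 hx.2 hxγ
  have hpos (k : ℕ) : ∀ i, 0 ≤ p k i := by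
    induction k with
    | zero => rw [hp0]; exact hx.2
    | succ k ih => exact (hp k).nonneg ih
  have hmem {t : ℝ} (ht : t ∈ Set.Icc 0 (N : ℝ)) :
      polygonalPath p N t ∈ angularThickening ε (γ '' Set.Icc 0 a) ∧
        ∀ i, 0 ≤ polygonalPath p N t i := by
    obtain ⟨k, hk⟩ := exists_mem_segment_polygonalPath p hN ht
    obtain ⟨_, _, _, _, hseg⟩ := hp k
    refine ⟨hseg hk, fun i => ?_⟩
    obtain ⟨u, v, hu, hv, -, huv⟩ := hk
    rw [← huv]
    simpa using add_nonneg (mul_nonneg hu (hpos k i)) (mul_nonneg hv (hpos (k + 1) i))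
  refine ⟨N, hN, fun t => NormedSpace.normalize (polygonalPath p N t),
    isDirectedPath_normalize_polygonalPath (fun h => h.1 rfl) hN hp hpos, ?_, ?_, ?_, ?_, ?_⟩
  · have := polygonalPath_natCast p hN (Nat.zero_le N)
    rw [Nat.cast_zero] at this
    simp only [this, hp0, NormedSpace.normalize_eq_self_of_norm_eq_one hx.1]
  · intro t ht
    refine ⟨NormedSpace.norm_normalize (hmem ht).1.1, fun i => ?_⟩
    simpa [NormedSpace.normalize] using mul_nonneg (inv_nonneg.2 (norm_nonneg _)) ((hmem ht).2 i)
  · intro t ht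
    obtain ⟨b, hb, hbt⟩ := hvisit t ht
    obtain ⟨k, hk, rfl⟩ := hA b hb
    refine ⟨k, ⟨by positivity, by exact_mod_cast hk⟩, ?_⟩
    simpa [polygonalPath_natCast p hN hk] using hbt
  · intro t ht
    obtain ⟨-, -, ⟨s, hs, rfl⟩, -, hlt⟩ := (hmem ht).1
    refine ⟨s, hs, ?_⟩
    rw [angle_comm]
    simpa using hlt.le
  · simpa [polygonalPath_natCast p hN le_rfl, hpN] using hqγ
end

section
/- Let n ≥ 1, let L ⊂ ℝ^n be the set of unit vectors with all coordinates nonnegative, and let W = {e_1,…,e_n}. Let γ : [0,a] → L be a W-directed path (a a positive integer), let ε₁, ε₂ > 0, and let l > 0. Then there exists R > 0 such that for every x ∈ ℝ^n with all coordinates nonnegative, ‖x‖ ≥ R, and angle(x, γ(0)) < ε₁/2, there exists a finite walk c : [0,b] → ℝ^n over V = {e_1,…,e_n} with c(0) = x, b ≥ l, such that: (i) every point c(t)/‖c(t)‖ (t ∈ [0,b]) is within angle ε₁ of some point of the image of γ, and every point of the image of γ is within angle ε₁ of some point c(t)/‖c(t)‖ (i.e. the Hausdorff distance, in the angular metric,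 between the radial projection of the image of c and the image of γ is at most ε₁); and (ii) angle(c(b)/‖c(b)‖, γ(a)) < ε₂. -/
open InnerProductGeometry

/-- A finite walk of length `b` over a family of vectors `v : Fin m → ℝ^n`. -/
def IsFiniteWalk {n m : ℕ} (v : Fin m → EuclideanSpace ℝ (Fin n)) (b : ℕ)
    (c : ℝ → EuclideanSpace ℝ (Fin n)) : Prop :=
  ∃ j : ℕ → Fin m, ∀ k : ℕ, k < b → ∀ t ∈ Set.Icc (k : ℝ) ((k : ℝ) + 1),
    c t = c (k : ℝ) + (t - (k : ℝ)) • v (j k)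

section Angles

variable {V : Type*} [NormedAddCommGroup V] [InnerProductSpace ℝ V]

lemma angle_le_of_cos_mul_le {x y : V} {h : ℝ} (hx : x ≠ 0) (hy : y ≠ 0) (hh : 0 ≤ h)
    (H : Real.cos h * (‖x‖ * ‖y‖) ≤ inner ℝ x y) : angle x y ≤ h := by
  rcases le_total Real.pi h with hp | hp
  · exact (angle_le_pi x y).trans hp
  rw [← cos_angle_mul_norm_mul_norm] at H
  have hpos : 0 < ‖x‖ * ‖y‖ := mul_pos (norm_pos_iff.2 hx) (norm_pos_iff.2 hy)
  exact (Real.strictAntiOn_cos.le_iff_ge ⟨hh, hp⟩ ⟨angle_nonneg x y, angle_le_pi x y⟩).1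
    (le_of_mul_le_mul_right H hpos)

lemma angle_le_of_norm_sub_sq_le {x y : V} {h ρ : ℝ} (hρ : 0 < ρ) (hx : ρ ≤ ‖x‖) (hy : ρ ≤ ‖y‖)
    (hh : 0 ≤ h) (H : ‖x - y‖ ^ 2 ≤ 2 * ρ ^ 2 * (1 - Real.cos h)) : angle x y ≤ h := by
  refine angle_le_of_cos_mul_le (norm_pos_iff.1 (hρ.trans_le hx)) (norm_pos_iff.1 (hρ.trans_le hy))
    hh ?_
  rw [norm_sub_sq_real] at H
  have h1 : ρ ^ 2 ≤ ‖x‖ * ‖y‖ := by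
    rw [sq]; exact mul_le_mul hx hy hρ.le (hρ.le.trans hx)
  have h2 := mul_le_mul_of_nonneg_right h1 (sub_nonneg.2 (Real.cos_le_one h))
  nlinarith [sq_nonneg (‖x‖ - ‖y‖)]

lemma norm_le_norm_add_of_inner_nonneg {x r : V} (h : 0 ≤ inner ℝ x r) : ‖x‖ ≤ ‖x + r‖ := by
  apply le_of_sq_le_sq _ (norm_nonneg _)
  rw [norm_add_sq_real]
  nlinarith [sq_nonneg ‖r‖]

/-- Adding the same vector to two vectors of equal norm does not increase the angle between
them, provided it makes an acute angle with both. -/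
lemma angle_add_right_le {x y u : V} (hx : x ≠ 0) (hxy : ‖x‖ = ‖y‖) (hxu : 0 ≤ inner ℝ x u)
    (hyu : 0 ≤ inner ℝ y u) : angle (x + u) (y + u) ≤ angle x y := by
  refine angle_le_of_norm_sub_sq_le (norm_pos_iff.2 hx) (norm_le_norm_add_of_inner_nonneg hxu)
    (hxy ▸ norm_le_norm_add_of_inner_nonneg hyu) (angle_nonneg x y) ?_
  rw [add_sub_add_right_eq_sub, norm_sub_sq_real, ← cos_angle_mul_norm_mul_norm, ← hxy]
  apply le_of_eq; ring

lemma angle_add_left_le_of_inner_nonneg {x v y : V} {θ : ℝ} (hx : x ≠ 0) (hy : y ≠ 0)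
    (hxv : 0 ≤ inner ℝ x v) (hxy : 0 ≤ inner ℝ x y) (hvy : 0 ≤ inner ℝ v y)
    (h1 : angle x y ≤ θ) (h2 : angle v y ≤ θ) : angle (x + v) y ≤ θ := by
  have hxv' : x + v ≠ 0 := by
    rw [← norm_pos_iff]
    exact (norm_pos_iff.2 hx).trans_le (norm_le_norm_add_of_inner_nonneg hxv)
  set m := max (angle x y) (angle v y)
  have hm0 : 0 ≤ m := (angle_nonneg x y).trans (le_max_left _ _)
  have hm : m ≤ Real.pi / 2 := by
    apply max_le <;> rw [angle, Real.arccos_le_pi_div_two] <;> positivity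
  refine le_trans (angle_le_of_cos_mul_le hxv' hy hm0 ?_) (max_le h1 h2)
  have hc : 0 ≤ Real.cos m := Real.cos_nonneg_of_mem_Icc ⟨by linarith, hm⟩
  have hcx : Real.cos m ≤ Real.cos (angle x y) :=
    Real.cos_le_cos_of_nonneg_of_le_pi (angle_nonneg _ _) (by linarith [Real.pi_pos])
      (le_max_left _ _)
  have hcv : Real.cos m ≤ Real.cos (angle v y) :=
    Real.cos_le_cos_of_nonneg_of_le_pi (angle_nonneg _ _) (by linarith [Real.pi_pos])
      (le_max_right _ _)
  rw [inner_add_left, ← cos_angle_mul_norm_mul_norm, ← cos_angle_mul_norm_mul_norm v]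
  calc Real.cos m * (‖x + v‖ * ‖y‖) ≤ Real.cos m * ((‖x‖ + ‖v‖) * ‖y‖) := by
        gcongr; exact norm_add_le _ _
    _ = Real.cos m * (‖x‖ * ‖y‖) + Real.cos m * (‖v‖ * ‖y‖) := by ring
    _ ≤ _ := by gcongr

lemma cos_min_pi_lt_one {h : ℝ} (hh : 0 < h) : Real.cos (min h Real.pi) < 1 := by
  have := Real.strictAntiOn_cos (a := 0) (b := min h Real.pi) ⟨le_rfl, Real.pi_pos.le⟩
    ⟨le_min hh.le Real.pi_pos.le, min_le_right _ _⟩ (lt_min hh Real.pi_pos)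
  rwa [Real.cos_zero] at this

lemma exists_ratio_angle_add_le {h : ℝ} (hh : 0 < h) :
    ∃ q : ℝ, 0 < q ∧ ∀ x r : V, x ≠ 0 → 0 ≤ inner ℝ x r → ‖r‖ ≤ q * ‖x‖ → angle x (x + r) ≤ h := by
  refine ⟨1 - Real.cos (min h Real.pi), sub_pos.2 (cos_min_pi_lt_one hh), fun x r hx hr hq => ?_⟩
  set h' := min h Real.pi
  have hx0 := norm_pos_iff.2 hx
  have hle := norm_le_norm_add_of_inner_nonneg hr
  refine le_trans (angle_le_of_cos_mul_le hx (norm_pos_iff.1 (hx0.trans_le hle))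
    (le_min hh.le Real.pi_pos.le) ?_) (min_le_left h Real.pi)
  rw [inner_add_right, real_inner_self_eq_norm_sq]
  change Real.cos h' * _ ≤ _
  rcases le_total (Real.cos h') 0 with hc | hc
  · have : Real.cos h' * (‖x‖ * ‖x + r‖) ≤ 0 := mul_nonpos_of_nonpos_of_nonneg hc (by positivity)
    nlinarith [sq_nonneg ‖x‖]
  · have h1 : ‖x + r‖ ≤ (2 - Real.cos h') * ‖x‖ := by
      linarith [norm_add_le x r]
    calc Real.cos h' * (‖x‖ * ‖x + r‖) ≤ Real.cos h' * (‖x‖ * ((2 - Real.cos h') * ‖x‖)) := by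
          gcongr
      _ ≤ ‖x‖ ^ 2 + 0 := by nlinarith [mul_nonneg (sq_nonneg ‖x‖) (sq_nonneg (1 - Real.cos h'))]
      _ ≤ _ := by gcongr

lemma half_le_norm_combination {y w : V} (hy : ‖y‖ = 1) (hw : ‖w‖ = 1) (hyw : 0 ≤ inner ℝ y w)
    {s : ℝ} (hs : s ∈ Set.Icc (0 : ℝ) 1) : 1 / 2 ≤ ‖(1 - s) • y + s • w‖ := by
  apply le_of_sq_le_sq _ (norm_nonneg _)
  rw [norm_add_sq_real, norm_smul, norm_smul, real_inner_smul_left, real_inner_smul_right, hy, hw]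
  simp only [Real.norm_eq_abs, mul_one, sq_abs]
  have := mul_nonneg (sub_nonneg.2 hs.2) (mul_nonneg hs.1 hyw)
  nlinarith [sq_nonneg (1 - 2 * s)]

lemma exists_modulus_angle_combination_le {y w : V} (hy : ‖y‖ = 1) (hw : ‖w‖ = 1)
    (hyw : 0 ≤ inner ℝ y w) {h : ℝ} (hh : 0 < h) :
    ∃ η : ℝ, 0 < η ∧ η < 1 ∧ ∀ s ∈ Set.Icc (0 : ℝ) 1, ∀ s' ∈ Set.Icc (0 : ℝ) 1, |s - s'| ≤ η →
      angle ((1 - s) • y + s • w) ((1 - s') • y + s' • w) ≤ h := by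
  have hlt := cos_min_pi_lt_one hh
  have hge := Real.neg_one_le_cos (min h Real.pi)
  set d := Real.cos (min h Real.pi)
  refine ⟨(1 - d) / 8, by linarith, by linarith, fun s hs s' hs' hss => ?_⟩
  refine le_trans (angle_le_of_norm_sub_sq_le (ρ := 1 / 2) (by norm_num)
    (half_le_norm_combination hy hw hyw hs) (half_le_norm_combination hy hw hyw hs')
    (le_min hh.le Real.pi_pos.le) ?_) (min_le_left h Real.pi)
  have hn : ‖(1 - s) • y + s • w - ((1 - s') • y + s' • w)‖ ≤ (1 - d) / 8 * 2 := by
    rw [show (1 - s) • y + s • w - ((1 - s') • y + s' • w) = (s - s') • (w - y) by module,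
      norm_smul]
    have := norm_sub_le w y
    rw [hy, hw] at this
    exact mul_le_mul hss (by linarith) (norm_nonneg _) (by linarith)
  change _ ≤ 2 * (1 / 2) ^ 2 * (1 - d)
  nlinarith [norm_nonneg ((1 - s) • y + s • w - ((1 - s') • y + s' • w))]

end Angles

section Orthant

variable {n : ℕ}

lemma inner_nonneg_of_coords_nonneg {x y : EuclideanSpace ℝ (Fin n)} (hx : ∀ i, 0 ≤ x i)
    (hy : ∀ i, 0 ≤ y i) : 0 ≤ inner ℝ x y := by
  rw [PiLp.inner_apply]
  exact Finset.sum_nonneg fun i _ => by simpa using mul_nonneg (hy i) (hx i)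

lemma single_one_coords_nonneg (j i : Fin n) :
    0 ≤ (EuclideanSpace.single j (1 : ℝ)) i := by
  rw [PiLp.single_apply]; split_ifs <;> norm_num

/-- There is a walk of length `b` along the standard basis vectors from `x` to `z` whose radial
projection is within Hausdorff angular distance `h` of `G`. -/
def ExistsWalkNear (b : ℕ) (G : Set (EuclideanSpace ℝ (Fin n))) (h : ℝ)
    (x z : EuclideanSpace ℝ (Fin n)) : Prop :=
  ∃ c : ℝ → EuclideanSpace ℝ (Fin n),
    IsFiniteWalk (fun i : Fin n => EuclideanSpace.single i (1 : ℝ)) b c ∧ c 0 = x ∧ c b = z ∧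
    (∀ t ∈ Set.Icc (0 : ℝ) b, ∃ g ∈ G, angle (c t) g ≤ h) ∧
    ∀ g ∈ G, ∃ t ∈ Set.Icc (0 : ℝ) b, angle (c t) g ≤ h

namespace ExistsWalkNear

variable {b b₁ b₂ : ℕ} {G G₁ G₂ : Set (EuclideanSpace ℝ (Fin n))} {h h' : ℝ}
  {x y z : EuclideanSpace ℝ (Fin n)}

lemma mono (H : ExistsWalkNear b G h x z) (hh : h ≤ h') : ExistsWalkNear b G h' x z := by
  obtain ⟨c, hc, h0, hb, h1, h2⟩ := H
  exact ⟨c, hc, h0, hb, fun t ht => (h1 t ht).imp fun g hg => ⟨hg.1, hg.2.trans hh⟩,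
    fun g hg => (h2 g hg).imp fun g hg => ⟨hg.1, hg.2.trans hh⟩⟩

lemma append (H₁ : ExistsWalkNear b₁ G₁ h x y) (H₂ : ExistsWalkNear b₂ G₂ h y z) :
    ExistsWalkNear (b₁ + b₂) (G₁ ∪ G₂) h x z := by
  obtain ⟨c₁, ⟨j₁, hj₁⟩, hs₁, he₁, hf₁, hg₁⟩ := H₁
  obtain ⟨c₂, ⟨j₂, hj₂⟩, hs₂, he₂, hf₂, hg₂⟩ := H₂
  set c : ℝ → EuclideanSpace ℝ (Fin n) := fun t => if t ≤ b₁ then c₁ t else c₂ (t - b₁) with hc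
  have hb₁ : (0 : ℝ) ≤ b₁ := b₁.cast_nonneg
  have hb₂ : (0 : ℝ) ≤ b₂ := b₂.cast_nonneg
  have hle : ∀ t : ℝ, t ≤ b₁ → c t = c₁ t := fun t ht => if_pos ht
  have hge : ∀ t : ℝ, b₁ ≤ t → c t = c₂ (t - b₁) := by
    intro t ht
    rcases ht.eq_or_lt with rfl | ht
    · rw [hle _ le_rfl, sub_self, he₁, hs₂]
    · exact if_neg ht.not_ge
  refine ⟨c, ⟨fun k => if k < b₁ then j₁ k else j₂ (k - b₁), fun k hk t ht => ?_⟩, ?_, ?_, ?_, ?_⟩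
  · by_cases hkb : k < b₁
    · have : (k : ℝ) + 1 ≤ b₁ := by exact_mod_cast hkb
      rw [hle t (ht.2.trans this), hle k (by linarith), hj₁ k hkb t ht]
      simp [hkb]
    · obtain ⟨m, rfl⟩ := Nat.exists_eq_add_of_le (not_lt.1 hkb)
      have hm : (0 : ℝ) ≤ m := m.cast_nonneg
      push_cast at ht ⊢
      rw [hge t (by linarith [ht.1]), hge _ (by linarith), hj₂ m (by omega) (t - b₁)
        ⟨by linarith [ht.1], by linarith [ht.2]⟩]
      simp [sub_sub]
  · rw [hle 0 hb₁, hs₁]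
  · push_cast
    rw [hge _ (by linarith), add_sub_cancel_left, he₂]
  · intro t ht
    push_cast at ht
    rcases le_total t b₁ with htb | htb
    · obtain ⟨g, hg, hga⟩ := hf₁ t ⟨ht.1, htb⟩
      exact ⟨g, Or.inl hg, by rwa [hle t htb]⟩
    · obtain ⟨g, hg, hga⟩ := hf₂ (t - b₁) ⟨by linarith, by linarith [ht.2]⟩
      exact ⟨g, Or.inr hg, by rwa [hge t htb]⟩
  · push_cast
    rintro g (hg | hg)
    · obtain ⟨t, ht, hta⟩ := hg₁ g hg
      exact ⟨t, ⟨ht.1, by linarith [ht.2]⟩, by rwa [hle t ht.2]⟩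
    · obtain ⟨t, ht, hta⟩ := hg₂ g hg
      refine ⟨t + b₁, ⟨by linarith [ht.1], by linarith [ht.2]⟩, ?_⟩
      rwa [hge _ (by linarith [ht.1]), add_sub_cancel_right]

lemma straight (j : Fin n) (b : ℕ)
    (h1 : ∀ t ∈ Set.Icc (0 : ℝ) b, ∃ g ∈ G, angle (x + t • EuclideanSpace.single j 1) g ≤ h)
    (h2 : ∀ g ∈ G, ∃ t ∈ Set.Icc (0 : ℝ) b, angle (x + t • EuclideanSpace.single j 1) g ≤ h) :
    ExistsWalkNear b G h x (x + (b : ℝ) • EuclideanSpace.single j 1) := by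
  refine ⟨fun t => x + t • EuclideanSpace.single j 1, ⟨fun _ => j, fun k _ t _ => ?_⟩, by simp,
    rfl, h1, h2⟩
  module

lemma zero [NeZero n] (h1 : ∀ g ∈ G, angle x g ≤ h) (h2 : G.Nonempty) :
    ExistsWalkNear 0 G h x x := by
  obtain ⟨g, hg⟩ := h2
  have := straight (x := x) (G := G) (h := h) (0 : Fin n) 0
    (fun t ht => ⟨g, hg, by simp_all⟩) (fun g hg => ⟨0, by simp, by simpa using h1 g hg⟩)
  simpa using this

/-- Every lattice vector of the nonnegative orthant is the displacement of a walk along the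
standard basis vectors all of whose points stay within a bounded nonnegative displacement. -/
lemma exists_length_of_mem_closure [NeZero n] {v : EuclideanSpace ℝ (Fin n)}
    (hv : v ∈ AddSubmonoid.closure
      (Set.range fun i : Fin n => EuclideanSpace.single i (1 : ℝ))) :
    (∀ i, 0 ≤ v i) ∧ ∃ k : ℕ, ‖v‖ ≤ k ∧ ∀ (x y : EuclideanSpace ℝ (Fin n)) (h : ℝ),
      (∀ r : EuclideanSpace ℝ (Fin n), (∀ i, 0 ≤ r i) → ‖r‖ ≤ k → angle (x + r) y ≤ h) →
      ExistsWalkNear k {y} h x (x + v) := by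
  induction hv using AddSubmonoid.closure_induction with
  | mem v hv =>
    obtain ⟨j, rfl⟩ := hv
    refine ⟨single_one_coords_nonneg j, 1, by simp, fun x y h H => ?_⟩
    have key : ∀ t ∈ Set.Icc (0 : ℝ) (1 : ℕ),
        angle (x + t • EuclideanSpace.single j (1 : ℝ)) y ≤ h := by
      intro t ht
      refine H _ (fun i => mul_nonneg ht.1 (single_one_coords_nonneg j i)) ?_
      rw [norm_smul]
      simpa [abs_of_nonneg ht.1] using ht.2
    simpa using straight (x := x) (G := {y}) (h := h) j 1 (fun t ht => ⟨y, rfl, key t ht⟩)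
      (by rintro _ rfl; exact ⟨0, by simp, key 0 (by simp)⟩)
  | zero =>
    refine ⟨fun i => le_rfl, 0, by simp, fun x y h H => ?_⟩
    simpa using zero (x := x) (G := {y}) (h := h)
      (by rintro _ rfl; simpa using H 0 (fun i => le_rfl) (by simp)) ⟨y, rfl⟩
  | add u v _ _ hu hv =>
    obtain ⟨hu0, k, huk, Hu⟩ := hu
    obtain ⟨hv0, m, hvm, Hv⟩ := hv
    refine ⟨fun i => add_nonneg (hu0 i) (hv0 i), k + m, ?_, fun x y h H => ?_⟩
    · push_cast; exact (norm_add_le _ _).trans (add_le_add huk hvm)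
    · have hm : (0 : ℝ) ≤ m := m.cast_nonneg
      push_cast at H
      have h1 := Hu x y h fun r hr hrk => H r hr (by linarith)
      have h2 := Hv (x + u) y h fun r hr hrk => by
        rw [add_assoc]
        exact H _ (fun i => add_nonneg (hu0 i) (hr i)) ((norm_add_le _ _).trans (by linarith))
      simpa [add_assoc] using h1.append h2

lemma iterate [NeZero n] {k : ℕ} {v : EuclideanSpace ℝ (Fin n)} {θ η R : ℝ} (hv : ∀ i, 0 ≤ v i)
    (hvk : ∀ (x y : EuclideanSpace ℝ (Fin n)) (h : ℝ),
      (∀ r : EuclideanSpace ℝ (Fin n), (∀ i, 0 ≤ r i) → ‖r‖ ≤ k → angle (x + r) y ≤ h) →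
      ExistsWalkNear k {y} h x (x + v))
    (hR : 0 < R) (hsmall : ∀ x : EuclideanSpace ℝ (Fin n), (∀ i, 0 ≤ x i) → R ≤ ‖x‖ →
      ∀ r : EuclideanSpace ℝ (Fin n), (∀ i, 0 ≤ r i) → ‖r‖ ≤ k → angle x (x + r) ≤ η)
    (hy0 : y ≠ 0) (hy : ∀ i, 0 ≤ y i) (hvy : angle v y ≤ θ) (T : ℕ) :
    ∀ x : EuclideanSpace ℝ (Fin n), (∀ i, 0 ≤ x i) → R ≤ ‖x‖ → angle x y ≤ θ →
      ExistsWalkNear (T * k) {y} (θ + η) x (x + T • v) := by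
  induction T with
  | zero =>
    intro x hx hxR hxy
    have hη := (angle_nonneg _ _).trans (hsmall x hx hxR 0 (fun i => le_rfl) (by simp))
    simpa using zero (x := x) (G := {y}) (h := θ + η) (by rintro _ rfl; linarith) ⟨y, rfl⟩
  | succ T ih =>
    intro x hx hxR hxy
    have h1 := hvk x y (θ + η) fun r hr hrk => by
      have h2 := hsmall x hx hxR r hr hrk
      have h3 := angle_le_angle_add_angle (x + r) x y
      rw [angle_comm (x + r) x] at h3
      linarith
    have hxv := inner_nonneg_of_coords_nonneg hx hv
    have h2 := ih (x + v) (fun i => add_nonneg (hx i) (hv i))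
      (hxR.trans (norm_le_norm_add_of_inner_nonneg hxv))
      (angle_add_left_le_of_inner_nonneg (norm_pos_iff.1 (hR.trans_le hxR)) hy0 hxv
        (inner_nonneg_of_coords_nonneg hx hy) (inner_nonneg_of_coords_nonneg hv hy) hxy hvy)
    have h3 := h1.append h2
    rw [Set.union_self, add_assoc, ← succ_nsmul'] at h3
    rwa [Nat.succ_mul, add_comm (T * k)]

lemma of_forall_angle_eq (H : ExistsWalkNear b G₁ h x z)
    (h₁ : ∀ g ∈ G₁, ∃ g' ∈ G₂, ∀ u, angle u g' = angle u g)
    (h₂ : ∀ g' ∈ G₂, ∃ g ∈ G₁, ∀ u, angle u g' = angle u g) : ExistsWalkNear b G₂ h x z := by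
  obtain ⟨c, hc, hs, he, hf, hg⟩ := H
  refine ⟨c, hc, hs, he, fun t ht => ?_, fun g' hg' => ?_⟩
  · obtain ⟨g, hgm, hga⟩ := hf t ht
    obtain ⟨g', hg', e⟩ := h₁ g hgm
    exact ⟨g', hg', (e _).trans_le hga⟩
  · obtain ⟨g, hgm, e⟩ := h₂ g' hg'
    obtain ⟨t, ht, hta⟩ := hg g hgm
    exact ⟨t, ht, (e _).trans_le hta⟩

end ExistsWalkNear

lemma exists_lattice_vector_angle_le [NeZero n] {y : EuclideanSpace ℝ (Fin n)} (hy1 : ‖y‖ = 1)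
    (hy : ∀ i, 0 ≤ y i) {h : ℝ} (hh : 0 < h) :
    ∃ v ∈ AddSubmonoid.closure (Set.range fun i : Fin n => EuclideanSpace.single i (1 : ℝ)),
      v ≠ 0 ∧ angle v y ≤ h := by
  obtain ⟨q, hq, H⟩ := exists_ratio_angle_add_le (V := EuclideanSpace ℝ (Fin n)) hh
  have hn : (1 : ℝ) ≤ n := by exact_mod_cast NeZero.one_le
  set N : ℝ := n / q with hN
  have hN0 : 0 < N := by positivity
  set v : EuclideanSpace ℝ (Fin n) := ∑ i, ⌈N * y i⌉₊ • EuclideanSpace.single i (1 : ℝ) with hv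
  have hvi : ∀ i, v i = ⌈N * y i⌉₊ := by
    intro i
    simp [hv, Pi.single_apply]
  have hr : ∀ i, 0 ≤ (v - N • y) i := by
    intro i
    simpa [hvi] using Nat.le_ceil (N * y i)
  have hr1 : ∀ i, (v - N • y) i ≤ 1 := by
    intro i
    have := Nat.ceil_lt_add_one (mul_nonneg hN0.le (hy i))
    simp only [PiLp.sub_apply, PiLp.smul_apply, smul_eq_mul, hvi]
    linarith
  have hrn : ‖v - N • y‖ ≤ n := by
    apply le_of_sq_le_sq _ (by positivity)
    rw [EuclideanSpace.norm_sq_eq]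
    calc ∑ i, ‖(v - N • y) i‖ ^ 2 ≤ ∑ _i : Fin n, (1 : ℝ) := by
          refine Finset.sum_le_sum fun i _ => ?_
          rw [Real.norm_eq_abs, abs_of_nonneg (hr i)]
          exact pow_le_one₀ (hr i) (hr1 i)
      _ = n := by simp
      _ ≤ (n : ℝ) ^ 2 := by nlinarith
  have hNy : ‖N • y‖ = N := by rw [norm_smul, hy1, mul_one, Real.norm_of_nonneg hN0.le]
  have hin : 0 ≤ inner ℝ (N • y) (v - N • y) :=
    inner_nonneg_of_coords_nonneg (fun i => mul_nonneg hN0.le (hy i)) hr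
  have hle := norm_le_norm_add_of_inner_nonneg hin
  have hang := H (N • y) (v - N • y) (norm_pos_iff.1 (hN0.trans_eq hNy.symm)) hin (by
    rw [hNy, hN, mul_div_cancel₀ _ hq.ne']; exact hrn)
  rw [add_sub_cancel] at hle hang
  refine ⟨v, AddSubmonoid.sum_mem _ fun i _ =>
    AddSubmonoid.nsmul_mem _ (AddSubmonoid.subset_closure (Set.mem_range_self i)) _,
    norm_pos_iff.1 ((hN0.trans_eq hNy.symm).trans_le hle), ?_⟩
  rwa [angle_smul_left_of_pos _ _ hN0, angle_comm] at hang

/-- From a far away point one can walk towards a given direction without getting noticeably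
farther from it. -/
lemma exists_walk_towards [NeZero n] {y : EuclideanSpace ℝ (Fin n)} (hy1 : ‖y‖ = 1)
    (hy : ∀ i, 0 ≤ y i) {θ η δ : ℝ} (hθ : 0 < θ) (hη : 0 < η) (hδ : 0 < δ) (l : ℝ) :
    ∃ R : ℝ, 0 < R ∧ ∀ x : EuclideanSpace ℝ (Fin n), (∀ i, 0 ≤ x i) → R ≤ ‖x‖ →
      angle x y ≤ θ → ∃ (b : ℕ) (z : EuclideanSpace ℝ (Fin n)), l ≤ b ∧ (∀ i, 0 ≤ z i) ∧
        ‖x‖ ≤ ‖z‖ ∧ angle z y ≤ δ ∧ ExistsWalkNear b {y} (θ + η) x z := by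
  obtain ⟨v, hv, hv0, hvy⟩ := exists_lattice_vector_angle_le hy1 hy (lt_min hθ (half_pos hδ))
  obtain ⟨hvn, k, hvk, Hk⟩ := ExistsWalkNear.exists_length_of_mem_closure hv
  obtain ⟨q, hq, Hq⟩ := exists_ratio_angle_add_le (V := EuclideanSpace ℝ (Fin n)) hη
  obtain ⟨p, hp, Hp⟩ := exists_ratio_angle_add_le (V := EuclideanSpace ℝ (Fin n)) (half_pos hδ)
  have hvpos := norm_pos_iff.2 hv0
  have hkpos : (0 : ℝ) < k := hvpos.trans_le hvk
  have hk1 : (1 : ℝ) ≤ k := by exact_mod_cast hkpos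
  have hy0 : y ≠ 0 := by rintro rfl; simp at hy1
  refine ⟨k / q, by positivity, fun x hx hxR hxy => ?_⟩
  have hxpos : 0 < ‖x‖ := lt_of_lt_of_le (by positivity) hxR
  set T := ⌈max l (‖x‖ / (p * ‖v‖))⌉₊
  have hT : max l (‖x‖ / (p * ‖v‖)) ≤ T := Nat.le_ceil _
  have hTl : l ≤ T := (le_max_left _ _).trans hT
  have hTx : ‖x‖ / (p * ‖v‖) ≤ T := (le_max_right _ _).trans hT
  have hTpos : (0 : ℝ) < T := lt_of_lt_of_le (by positivity) hTx
  have hTv : ∀ i, 0 ≤ (T • v) i := fun i => by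
    simpa using mul_nonneg hTpos.le (hvn i)
  refine ⟨T * k, x + T • v, ?_, fun i => add_nonneg (hx i) (hTv i),
    norm_le_norm_add_of_inner_nonneg (inner_nonneg_of_coords_nonneg hx hTv), ?_, ?_⟩
  · push_cast; nlinarith
  · have h1 := Hp (T • v) x (by
        rw [← Nat.cast_smul_eq_nsmul ℝ]
        exact smul_ne_zero hTpos.ne' hv0)
      (inner_nonneg_of_coords_nonneg hTv hx) (by
        rw [div_le_iff₀ (by positivity)] at hTx
        rw [← Nat.cast_smul_eq_nsmul ℝ, norm_smul, Real.norm_of_nonneg hTpos.le]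
        linarith)
    have h2 := angle_le_angle_add_angle (x + T • v) (T • v) y
    rw [add_comm x, angle_comm _ (T • v)] at h2
    rw [add_comm x]
    have h3 : angle (T • v) y = angle v y := by
      rw [← Nat.cast_smul_eq_nsmul ℝ, angle_smul_left_of_pos _ _ hTpos]
    have := min_le_right θ (δ / 2)
    linarith
  · refine ExistsWalkNear.iterate (R := k / q) hvn Hk (by positivity) (fun x hx hxR r hr hrk => ?_)
      hy0 hy (hvy.trans (min_le_left _ _)) T x hx hxR hxy
    refine Hq x r (norm_pos_iff.1 (lt_of_lt_of_le (by positivity) hxR))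
      (inner_nonneg_of_coords_nonneg hx hr) (hrk.trans ?_)
    rw [div_le_iff₀ hq] at hxR
    linarith

/-- From a far away point whose direction is near `y`, walking towards a basis vector follows
the spherical segment from `y` towards that basis vector. -/
lemma exists_walk_along_segment {y : EuclideanSpace ℝ (Fin n)} (hy1 : ‖y‖ = 1)
    (hy : ∀ i, 0 ≤ y i) (j : Fin n) {S h : ℝ} (hS : S ∈ Set.Icc (0 : ℝ) 1) (hh : 0 < h) :
    ∃ R : ℝ, 0 < R ∧ ∀ x : EuclideanSpace ℝ (Fin n), (∀ i, 0 ≤ x i) → R ≤ ‖x‖ →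
      ∀ δ : ℝ, angle x y ≤ δ → ∃ (b : ℕ) (z : EuclideanSpace ℝ (Fin n)), (∀ i, 0 ≤ z i) ∧
        ‖x‖ ≤ ‖z‖ ∧ angle z ((1 - S) • y + S • EuclideanSpace.single j 1) ≤ δ + h ∧
        ExistsWalkNear b
          ((fun s : ℝ => (1 - s) • y + s • EuclideanSpace.single j 1) '' Set.Icc 0 S)
          (δ + h) x z := by
  set w : EuclideanSpace ℝ (Fin n) := EuclideanSpace.single j 1 with hw
  have hw0 : ∀ i, 0 ≤ w i := single_one_coords_nonneg j
  have hw1 : ‖w‖ = 1 := by simp [hw]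
  obtain ⟨η, hη0, hη1, Hη⟩ := exists_modulus_angle_combination_le hy1 hw1
    (inner_nonneg_of_coords_nonneg hy hw0) (half_pos hh)
  obtain ⟨q, hq, Hq⟩ := exists_ratio_angle_add_le (V := EuclideanSpace ℝ (Fin n)) (half_pos hh)
  refine ⟨1 / q, by positivity, fun x hx hxR δ hxδ => ?_⟩
  have hx0 : 0 < ‖x‖ := lt_of_lt_of_le (by positivity) hxR
  have htw : ∀ t : ℝ, 0 ≤ t → ∀ i, 0 ≤ (t • w) i := fun t ht i => mul_nonneg ht (hw0 i)
  have hnorm : ∀ t : ℝ, 0 ≤ t → ‖x‖ ≤ ‖x + t • w‖ := fun t ht =>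
    norm_le_norm_add_of_inner_nonneg (inner_nonneg_of_coords_nonneg hx (htw t ht))
  set τ : ℝ → ℝ := fun s => ‖x‖ * s / (1 - s) with hτ
  have hτ0 : ∀ s, 0 ≤ s → s < 1 → 0 ≤ τ s := fun s h0 h1 =>
    div_nonneg (mul_nonneg hx0.le h0) (by linarith)
  have hmatch : ∀ s, 0 ≤ s → s < 1 → angle (x + τ s • w) ((1 - s) • y + s • w) ≤ δ := by
    intro s h0 h1
    have h1' : 0 < 1 - s := by linarith
    have hP : (1 - s) • y + s • w = ((1 - s) / ‖x‖) • (‖x‖ • y + τ s • w) := by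
      rw [smul_add, smul_smul, smul_smul, div_mul_cancel₀ _ hx0.ne']
      congr 2
      simp only [hτ]
      field_simp
    rw [hP, angle_smul_right_of_pos _ _ (by positivity)]
    refine (angle_add_right_le (norm_pos_iff.1 hx0) (by simp [norm_smul, hy1])
      (inner_nonneg_of_coords_nonneg hx (htw _ (hτ0 s h0 h1)))
      (inner_nonneg_of_coords_nonneg (fun i => mul_nonneg hx0.le (hy i))
        (htw _ (hτ0 s h0 h1)))).trans ?_
    rwa [angle_smul_right_of_pos _ _ hx0]
  have hmono : ∀ s s', 0 ≤ s → s ≤ s' → s' < 1 → τ s ≤ τ s' := by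
    intro s s' h0 hss h1
    simp only [hτ]
    exact div_le_div₀ (mul_nonneg hx0.le (h0.trans hss)) (by gcongr) (by linarith) (by linarith)
  set S' := min S (1 - η) with hS'
  have hS'0 : 0 ≤ S' := le_min hS.1 (by linarith)
  have hS'1 : S' < 1 := (min_le_right _ _).trans_lt (by linarith)
  set b := ⌊τ S'⌋₊ with hb
  have hbτ : (b : ℝ) ≤ τ S' := Nat.floor_le (hτ0 _ hS'0 hS'1)
  have hτb : τ S' < b + 1 := Nat.lt_floor_add_one _
  have hb0 : (0 : ℝ) ≤ b := b.cast_nonneg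
  have hnear : ∀ s ∈ Set.Icc 0 S, angle (x + min (τ (min s (1 - η))) b • w)
      ((1 - s) • y + s • w) ≤ δ + h := by
    intro s hs
    set s' := min s (1 - η)
    have hs'0 : 0 ≤ s' := le_min hs.1 (by linarith)
    have hs'1 : s' < 1 := (min_le_right _ _).trans_lt (by linarith)
    have hs'S : s' ≤ S' := min_le_min_right _ hs.2
    have ht0 : 0 ≤ min (τ s') b := le_min (hτ0 _ hs'0 hs'1) hb0
    have hd0 : 0 ≤ τ s' - min (τ s') b := sub_nonneg.2 (min_le_left _ _)
    have hd1 : τ s' - min (τ s') b ≤ 1 := by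
      have := hmono s' S' hs'0 hs'S hS'1
      rcases min_cases (τ s') (b : ℝ) with ⟨e, _⟩ | ⟨e, _⟩ <;> rw [e] <;> linarith
    have h1 := Hq (x + min (τ s') b • w) ((τ s' - min (τ s') b) • w)
      (norm_pos_iff.1 (hx0.trans_le (hnorm _ ht0)))
      (inner_nonneg_of_coords_nonneg (fun i => add_nonneg (hx i) (htw _ ht0 i)) (htw _ hd0)) (by
        rw [norm_smul, hw1, mul_one, Real.norm_of_nonneg hd0]
        rw [div_le_iff₀ hq] at hxR
        have := mul_le_mul_of_nonneg_left (hnorm _ ht0) hq.le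
        linarith)
    rw [add_assoc, ← add_smul, add_sub_cancel] at h1
    have h2 := hmatch s' hs'0 hs'1
    have h3 := Hη s' ⟨hs'0, hs'1.le⟩ s ⟨hs.1, hs.2.trans hS.2⟩ (by
      have := hs.2.trans hS.2
      rw [abs_le]
      rcases min_cases s (1 - η) with ⟨e, _⟩ | ⟨e, _⟩ <;> simp only [s', e] <;>
        constructor <;> linarith)
    have h4 := angle_le_angle_add_angle (x + min (τ s') b • w) (x + τ s' • w)
      ((1 - s) • y + s • w)
    have h5 := angle_le_angle_add_angle (x + τ s' • w) ((1 - s') • y + s' • w)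
      ((1 - s) • y + s • w)
    linarith
  refine ⟨b, x + (b : ℝ) • w, fun i => add_nonneg (hx i) (htw _ hb0 i), hnorm _ hb0, ?_,
    ExistsWalkNear.straight j b ?_ ?_⟩
  · have := hnear S ⟨hS.1, le_rfl⟩
    rwa [min_eq_right hbτ] at this
  · intro t ht
    have hxt : 0 < ‖x‖ + t := by linarith [ht.1]
    have hs0 : 0 ≤ t / (‖x‖ + t) := div_nonneg ht.1 hxt.le
    have hs1 : t / (‖x‖ + t) < 1 := by rw [div_lt_one hxt]; linarith
    have hτt : τ (t / (‖x‖ + t)) = t := by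
      simp only [hτ]
      rw [div_eq_iff (by linarith)]
      field_simp
      ring
    have hsS : t / (‖x‖ + t) ≤ S := by
      refine le_trans ?_ (min_le_left S (1 - η))
      have := ht.2.trans hbτ
      simp only [hτ] at this
      rw [le_div_iff₀ (by linarith)] at this
      rw [div_le_iff₀ hxt]
      change t ≤ S' * _
      linarith
    refine ⟨_, ⟨t / (‖x‖ + t), ⟨hs0, hsS⟩, rfl⟩, ?_⟩
    have := hmatch _ hs0 hs1
    rw [hτt] at this
    exact this.trans (by linarith)
  · rintro _ ⟨s, hs, rfl⟩
    refine ⟨min (τ (min s (1 - η))) b, ⟨le_min (hτ0 _ (le_min hs.1 (by linarith))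
      ((min_le_right _ _).trans_lt (by linarith))) hb0, min_le_right _ _⟩, hnear s hs⟩

lemma exists_walk_along_directed_path_piece [NeZero n] {a : ℕ} {γ : ℝ → EuclideanSpace ℝ (Fin n)}
    (hγ : IsDirectedPath (Set.range fun i : Fin n => EuclideanSpace.single i (1 : ℝ)) a γ)
    (hγL : ∀ t ∈ Set.Icc (0 : ℝ) a, γ t ∈ {y : EuclideanSpace ℝ (Fin n) | ‖y‖ = 1 ∧ ∀ i, 0 ≤ y i})
    {k : ℕ} (hk : k < a) {h : ℝ} (hh : 0 < h) :
    ∃ R : ℝ, 0 < R ∧ ∀ x : EuclideanSpace ℝ (Fin n), (∀ i, 0 ≤ x i) → R ≤ ‖x‖ →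
      ∀ δ : ℝ, angle x (γ k) ≤ δ → ∃ (b : ℕ) (z : EuclideanSpace ℝ (Fin n)), (∀ i, 0 ≤ z i) ∧
        ‖x‖ ≤ ‖z‖ ∧ angle z (γ (k + 1)) ≤ δ + h ∧
        ExistsWalkNear b (γ '' Set.Icc (k : ℝ) (k + 1)) (δ + h) x z := by
  have hka : (k : ℝ) + 1 ≤ a := by exact_mod_cast hk
  have hk0 : (0 : ℝ) ≤ k := k.cast_nonneg
  have hright : (k : ℝ) + 1 ∈ Set.Icc (k : ℝ) (k + 1) := ⟨by linarith, le_rfl⟩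
  have hpiece := hγ.2 (k + 1) (by omega) (by omega)
  push_cast at hpiece
  rw [add_sub_cancel_right] at hpiece
  obtain hconst | ⟨-, _, ⟨j, rfl⟩, s, hsc, hsm, hs0, hs⟩ := hpiece
  · refine ⟨1, one_pos, fun x hx _ δ hxδ => ⟨0, x, hx, le_rfl, ?_, .zero ?_ ⟨_, _, hright, rfl⟩⟩⟩
    · rw [hconst _ hright]; linarith
    · rintro _ ⟨t, ht, rfl⟩
      rw [hconst t ht]; linarith
  · obtain ⟨hy1, hy⟩ := hγL k ⟨hk0, by linarith⟩
    obtain ⟨R, hR, H⟩ := exists_walk_along_segment hy1 hy j (hs _ hright).1 hh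
    have hangle : ∀ t ∈ Set.Icc (k : ℝ) (k + 1), ∀ u, angle u (γ t) =
        angle u ((1 - s t) • γ k + s t • EuclideanSpace.single j 1) := by
      intro t ht u
      have hpos := half_le_norm_combination hy1 (w := EuclideanSpace.single j 1) (by simp)
        (inner_nonneg_of_coords_nonneg hy (single_one_coords_nonneg j)) (hs t ht).1
      rw [(hs t ht).2]
      exact angle_smul_right_of_pos _ _ (inv_pos.2 (by linarith))
    refine ⟨R, hR, fun x hx hxR δ hxδ => ?_⟩
    obtain ⟨b, z, hz, hxz, hzS, W⟩ := H x hx hxR δ hxδ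
    refine ⟨b, z, hz, hxz, by rwa [hangle _ hright], W.of_forall_angle_eq ?_ ?_⟩
    · rintro _ ⟨σ, hσ, rfl⟩
      have hivt := intermediate_value_Icc (by linarith : (k : ℝ) ≤ k + 1) hsc
      rw [hs0] at hivt
      obtain ⟨t, ht, rfl⟩ := hivt hσ
      exact ⟨γ t, ⟨t, ht, rfl⟩, hangle t ht⟩
    · rintro _ ⟨t, ht, rfl⟩
      exact ⟨_, ⟨s t, ⟨(hs t ht).1.1, hsm ht hright ht.2⟩, rfl⟩, hangle t ht⟩

lemma exists_walk_along_directed_path [NeZero n] {a : ℕ} {γ : ℝ → EuclideanSpace ℝ (Fin n)}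
    (hγ : IsDirectedPath (Set.range fun i : Fin n => EuclideanSpace.single i (1 : ℝ)) a γ)
    (hγL : ∀ t ∈ Set.Icc (0 : ℝ) a, γ t ∈ {y : EuclideanSpace ℝ (Fin n) | ‖y‖ = 1 ∧ ∀ i, 0 ≤ y i})
    (k : ℕ) (hk : k ≤ a) {h : ℝ} (hh : 0 < h) :
    ∃ R : ℝ, 0 < R ∧ ∃ δ : ℝ, 0 < δ ∧ ∀ x : EuclideanSpace ℝ (Fin n), (∀ i, 0 ≤ x i) →
      R ≤ ‖x‖ → angle x (γ 0) ≤ δ → ∃ (b : ℕ) (z : EuclideanSpace ℝ (Fin n)), (∀ i, 0 ≤ z i) ∧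
        ‖x‖ ≤ ‖z‖ ∧ angle z (γ k) ≤ h ∧ ExistsWalkNear b (γ '' Set.Icc (0 : ℝ) k) h x z := by
  induction k generalizing h with
  | zero =>
    refine ⟨1, one_pos, h, hh, fun x hx _ hxδ => ⟨0, x, hx, le_rfl, by simpa using hxδ, .zero ?_ ?_⟩⟩
    · simpa using hxδ
    · simp
  | succ k ih =>
    obtain ⟨R₁, hR₁, δ, hδ, H₁⟩ := ih (by omega) (half_pos hh)
    obtain ⟨R₂, hR₂, H₂⟩ := exists_walk_along_directed_path_piece hγ hγL hk (half_pos hh)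
    refine ⟨max R₁ R₂, lt_max_of_lt_left hR₁, δ, hδ, fun x hx hxR hxδ => ?_⟩
    obtain ⟨b₁, z, hz, hxz, hzγ, W₁⟩ := H₁ x hx ((le_max_left _ _).trans hxR) hxδ
    obtain ⟨b₂, u, hu, hzu, huγ, W₂⟩ := H₂ z hz (((le_max_right _ _).trans hxR).trans hxz) _ hzγ
    rw [add_halves] at huγ W₂
    have W := (W₁.mono (by linarith)).append W₂
    rw [← Set.image_union, Set.Icc_union_Icc_eq_Icc k.cast_nonneg (by linarith)] at W
    push_cast
    exact ⟨b₁ + b₂, u, hu, hxz.trans hzu, huγ, W⟩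

end Orthant

/-- Let `L` be the set of nonnegative unit vectors in `ℝ^n`,
`W = {e_1, …, e_n}`, and let `γ : [0, a] → L` be a `W`-directed path.  Given
`ε₁, ε₂ > 0` and `l > 0`, there is `R > 0` such that every `x` with nonnegative
coordinates, `‖x‖ ≥ R` and `angle x (γ 0) < ε₁ / 2` is the starting point of a finite
walk `c` over `{e_1, …, e_n}` of length `b ≥ l` whose radial projection stays within
Hausdorff angular distance `ε₁` of `γ` and whose endpoint projects within angle `ε₂`
of `γ a`. -/
theorem stmt4 (n : ℕ) (hn : 1 ≤ n)
    (L : Set (EuclideanSpace ℝ (Fin n)))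
    (hL : L = {y : EuclideanSpace ℝ (Fin n) | ‖y‖ = 1 ∧ ∀ i, 0 ≤ y i})
    (W : Set (EuclideanSpace ℝ (Fin n)))
    (hW : W = Set.range (fun i : Fin n => EuclideanSpace.single i (1 : ℝ)))
    (a : ℕ) (ha : 0 < a)
    (γ : ℝ → EuclideanSpace ℝ (Fin n))
    (hγ : IsDirectedPath W a γ)
    (hγL : ∀ t ∈ Set.Icc (0 : ℝ) (a : ℝ), γ t ∈ L)
    (ε₁ ε₂ : ℝ) (hε₁ : 0 < ε₁) (hε₂ : 0 < ε₂) (l : ℝ) (hl : 0 < l) :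
    ∃ R : ℝ, 0 < R ∧
      ∀ x : EuclideanSpace ℝ (Fin n), (∀ i, 0 ≤ x i) → R ≤ ‖x‖ →
        angle x (γ 0) < ε₁ / 2 →
        ∃ b : ℕ, l ≤ (b : ℝ) ∧ ∃ c : ℝ → EuclideanSpace ℝ (Fin n),
          IsFiniteWalk (fun i : Fin n => EuclideanSpace.single i (1 : ℝ)) b c ∧
          c 0 = x ∧
          (∀ t ∈ Set.Icc (0 : ℝ) (b : ℝ), ∃ t' ∈ Set.Icc (0 : ℝ) (a : ℝ),
            angle (c t) (γ t') ≤ ε₁) ∧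
          (∀ t' ∈ Set.Icc (0 : ℝ) (a : ℝ), ∃ t ∈ Set.Icc (0 : ℝ) (b : ℝ),
            angle (c t) (γ t') ≤ ε₁) ∧
          angle (c (b : ℝ)) (γ (a : ℝ)) < ε₂ := by
  have : NeZero n := ⟨by omega⟩
  subst hL hW
  have h00 : (0 : ℝ) ∈ Set.Icc (0 : ℝ) a := ⟨le_rfl, a.cast_nonneg⟩
  obtain ⟨R₂, hR₂, δ, hδ, H₂⟩ := exists_walk_along_directed_path hγ hγL a le_rfl
    (lt_min hε₁ (half_pos hε₂))
  obtain ⟨R₁, hR₁, H₁⟩ := exists_walk_towards (hγL 0 h00).1 (hγL 0 h00).2 (half_pos hε₁)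
    (half_pos hε₁) hδ l
  refine ⟨max R₁ R₂, lt_max_of_lt_left hR₁, fun x hx hxR hxγ => ?_⟩
  obtain ⟨b₁, z, hb₁, hz, hxz, hzγ, W₁⟩ := H₁ x hx ((le_max_left _ _).trans hxR) hxγ.le
  obtain ⟨b₂, u, -, -, huγ, W₂⟩ := H₂ z hz (((le_max_right _ _).trans hxR).trans hxz) hzγ
  rw [add_halves] at W₁
  obtain ⟨c, hc, hs, he, hf, hg⟩ := W₁.append (W₂.mono (min_le_left _ _))
  have hG : {γ 0} ∪ γ '' Set.Icc (0 : ℝ) a = γ '' Set.Icc (0 : ℝ) a :=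
    Set.union_eq_right.2 (Set.singleton_subset_iff.2 ⟨0, h00, rfl⟩)
  rw [hG] at hf hg
  refine ⟨b₁ + b₂, ?_, c, hc, hs, fun t ht => ?_, fun t' ht' => hg _ ⟨t', ht', rfl⟩, ?_⟩
  · push_cast
    linarith [(b₂.cast_nonneg : (0 : ℝ) ≤ b₂)]
  · obtain ⟨_, ⟨t', ht', rfl⟩, h⟩ := hf t ht
    exact ⟨t', ht', h⟩
  · rw [he]
    linarith [huγ.trans (min_le_right _ _)]
end

section
/- Let n ≥ 1 and let K ⊂ ℝ^n be the standard simplex, i.e. the convex hull of the standard basis vectors e_1,…,e_n. Then for every x ∈ K one has ‖x‖ ≥ 1/√n, and for all x, y ∈ K the angle between x and y satisfies angle(x,y) ≤ 2π√n·‖x − y‖. -/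
open InnerProductGeometry

/-- Two vectors of norm at least `m` which subtend the angle `θ` are at distance at least
`2 * m * θ / π`. -/
theorem two_mul_angle_le_pi_mul_norm_sub {V : Type*} [NormedAddCommGroup V]
    [InnerProductSpace ℝ V] {x y : V} {m : ℝ} (hm : 0 ≤ m) (hx : m ≤ ‖x‖) (hy : m ≤ ‖y‖) :
    2 * m * angle x y ≤ Real.pi * ‖x - y‖ := by
  have hπ := Real.pi_pos
  have h0 := angle_nonneg x y
  have hcos : Real.cos (angle x y) ≤ 1 - 2 / Real.pi ^ 2 * angle x y ^ 2 :=
    Real.cos_le_one_sub_mul_cos_sq (by rw [abs_of_nonneg h0]; exact angle_le_pi x y)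
  have hdist : ‖x - y‖ ^ 2 = ‖x‖ ^ 2 - 2 * (Real.cos (angle x y) * (‖x‖ * ‖y‖)) + ‖y‖ ^ 2 := by
    rw [cos_angle_mul_norm_mul_norm, norm_sub_sq_real]
  have hmul : m * m ≤ ‖x‖ * ‖y‖ := mul_le_mul hx hy hm (norm_nonneg x)
  have hquad : 2 / Real.pi ^ 2 * angle x y ^ 2 * (m * m) ≤
      (1 - Real.cos (angle x y)) * (‖x‖ * ‖y‖) :=
    mul_le_mul (by linarith) hmul (by positivity) (by linarith [Real.cos_le_one (angle x y)])
  have hsq : 4 / Real.pi ^ 2 * angle x y ^ 2 * m ^ 2 ≤ ‖x - y‖ ^ 2 := by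
    have := sq_nonneg (‖x‖ - ‖y‖)
    calc 4 / Real.pi ^ 2 * angle x y ^ 2 * m ^ 2
        = 2 * (2 / Real.pi ^ 2 * angle x y ^ 2 * (m * m)) := by ring
      _ ≤ 2 * ((1 - Real.cos (angle x y)) * (‖x‖ * ‖y‖)) := by linarith
      _ ≤ ‖x - y‖ ^ 2 := by rw [hdist]; linarith
  refine le_of_sq_le_sq ?_ (by positivity)
  calc (2 * m * angle x y) ^ 2
      = Real.pi ^ 2 * (4 / Real.pi ^ 2 * angle x y ^ 2 * m ^ 2) := by field_simp; ring
    _ ≤ Real.pi ^ 2 * ‖x - y‖ ^ 2 := by gcongr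
    _ = (Real.pi * ‖x - y‖) ^ 2 := by ring

/-- The coordinates of a point of the standard simplex sum to one. -/
theorem sum_eq_one_of_mem_convexHull_single {ι : Type*} [Fintype ι] [DecidableEq ι]
    {x : EuclideanSpace ℝ ι}
    (hx : x ∈ convexHull ℝ (Set.range fun i : ι => EuclideanSpace.single i (1 : ℝ))) :
    ∑ i, x i = 1 := by
  refine convexHull_min (t := {z : EuclideanSpace ℝ ι | ∑ i, z i = 1}) ?_ ?_ hx
  · rintro _ ⟨i, rfl⟩
    simp
  · intro u hu v hv a b _ _ hab
    simp only [Set.mem_ofPred_eq] at hu hv ⊢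
    simp [Finset.sum_add_distrib, ← Finset.mul_sum, hu, hv, hab]

/-- A vector whose coordinates sum to one has norm at least `1 / √(card ι)`. -/
theorem one_div_sqrt_card_le_norm_of_sum_eq_one {ι : Type*} [Fintype ι]
    {x : EuclideanSpace ℝ ι} (hx : ∑ i, x i = 1) :
    1 / Real.sqrt (Fintype.card ι) ≤ ‖x‖ := by
  have h : (1 : ℝ) ≤ Fintype.card ι * ‖x‖ ^ 2 := by
    rw [EuclideanSpace.real_norm_sq_eq]
    simpa [hx] using sq_sum_le_card_mul_sum_sq (s := Finset.univ) (f := fun i => x i)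
  refine div_le_of_le_mul₀ (Real.sqrt_nonneg _) (norm_nonneg x) ?_
  refine le_of_sq_le_sq ?_ (by positivity)
  rw [mul_pow, Real.sq_sqrt (Nat.cast_nonneg _)]
  linarith

/-- Let `K ⊂ ℝ^n` be the standard simplex, the convex hull of the standard
basis vectors.  Then every `x ∈ K` has `‖x‖ ≥ 1/√n`, and for all `x, y ∈ K` the angle
between `x` and `y` is at most `2π√n · ‖x - y‖`. -/
theorem stmt5 (n : ℕ) (hn : 1 ≤ n)
    (K : Set (EuclideanSpace ℝ (Fin n)))
    (hK : K = convexHull ℝ (Set.range (fun i : Fin n => EuclideanSpace.single i (1 : ℝ)))) :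
    (∀ x ∈ K, 1 / Real.sqrt n ≤ ‖x‖) ∧
    (∀ x ∈ K, ∀ y ∈ K, angle x y ≤ 2 * Real.pi * Real.sqrt n * ‖x - y‖) := by
  have hnorm : ∀ x ∈ K, 1 / Real.sqrt n ≤ ‖x‖ := by
    intro x hx
    rw [hK] at hx
    simpa using one_div_sqrt_card_le_norm_of_sum_eq_one (sum_eq_one_of_mem_convexHull_single hx)
  refine ⟨hnorm, fun x hx y hy => ?_⟩
  have hs : 0 < Real.sqrt n := Real.sqrt_pos.2 (by exact_mod_cast hn)
  have h := two_mul_angle_le_pi_mul_norm_sub (by positivity) (hnorm x hx) (hnorm y hy)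
  have hnn : 0 ≤ Real.sqrt n * (Real.pi * ‖x - y‖) := by positivity
  calc angle x y ≤ 2 * angle x y := by linarith [angle_nonneg x y]
    _ = Real.sqrt n * (2 * (1 / Real.sqrt n) * angle x y) := by field_simp
    _ ≤ Real.sqrt n * (Real.pi * ‖x - y‖) := by gcongr
    _ ≤ 2 * Real.pi * Real.sqrt n * ‖x - y‖ := by linarith
end

section
/- Let n ≥ 1, let K ⊂ ℝ^n be the convex hull of the standard basis vectors W = {e_1,…,e_n}. Let q ∈ K, let W' be a nonempty subset of W, let K' be the convex hull of W' (a face of K), and let q' be a point of the relative interior of K' (i.e. q' = Σ_{w∈W'} t_w·w with all t_w > 0 and Σ t_w = 1). Then for every ε > 0 there exists a positive integer a and a W-directed path γ : [0,a] → K with γ(0) = q, ‖γ(a) − q'‖ < ε, and such that every point of the image of γ lies within distance ε of the line segment from q to q'. -/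
/-- A `W`-directed path in a Euclidean simplex: on each interval `[k-1, k]` the path is
either constant or an injective affine path `t ↦ γ (k-1) + (t-(k-1))·s·(w - γ (k-1))`
for some vertex `w ∈ W` and some `s ∈ (0, 1]` (an initial subsegment of the segment
from `γ (k-1)` to `w`). -/
def IsEuclidDirectedPath {n : ℕ} (W : Set (EuclideanSpace ℝ (Fin n))) (a : ℕ)
    (γ : ℝ → EuclideanSpace ℝ (Fin n)) : Prop :=
  ∀ k : ℕ, 1 ≤ k → k ≤ a →
    (∀ t ∈ Set.Icc ((k : ℝ) - 1) (k : ℝ), γ t = γ ((k : ℝ) - 1)) ∨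
    (Set.InjOn γ (Set.Icc ((k : ℝ) - 1) (k : ℝ)) ∧
      ∃ w ∈ W, ∃ s : ℝ, s ∈ Set.Ioc (0 : ℝ) 1 ∧
        ∀ t ∈ Set.Icc ((k : ℝ) - 1) (k : ℝ),
          γ t = γ ((k : ℝ) - 1) + ((t - ((k : ℝ) - 1)) * s) • (w - γ ((k : ℝ) - 1)))

open scoped Pointwise

/-- `y` is the endpoint of a `W`-directed path which starts at `q` and stays in `U`. -/
def DirectedReachable {n : ℕ} (W U : Set (EuclideanSpace ℝ (Fin n)))
    (q y : EuclideanSpace ℝ (Fin n)) : Prop :=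
  ∃ a : ℕ, 0 < a ∧ ∃ γ : ℝ → EuclideanSpace ℝ (Fin n),
    ContinuousOn γ (Set.Icc 0 (a : ℝ)) ∧ IsEuclidDirectedPath W a γ ∧ γ 0 = q ∧
    (∀ u ∈ Set.Icc (0 : ℝ) (a : ℝ), γ u ∈ U) ∧ γ (a : ℝ) = y

namespace DirectedReachable

variable {n : ℕ} {W U : Set (EuclideanSpace ℝ (Fin n))} {q y w : EuclideanSpace ℝ (Fin n)}

theorem refl (hq : q ∈ U) : DirectedReachable W U q q :=
  ⟨1, one_pos, fun _ => q, continuousOn_const, fun _ _ _ => Or.inl fun _ _ => rfl, rfl,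
    fun _ _ => hq, rfl⟩

/-- A directed path in a convex set can be prolonged by a directed segment whose endpoint
lies in the set. -/
theorem step (hU : Convex ℝ U) (h : DirectedReachable W U q y) (hw : w ∈ W) {s : ℝ}
    (hs : s ∈ Set.Ioc (0 : ℝ) 1) (hy : y + s • (w - y) ∈ U) :
    DirectedReachable W U q (y + s • (w - y)) := by
  obtain ⟨a, ha, γ, hc, hd, h0, hin, rfl⟩ := h
  let δ : ℝ → EuclideanSpace ℝ (Fin n) := fun u =>
    if u ≤ a then γ u else γ a + ((u - a) * s) • (w - γ a)
  have hδ₁ : ∀ u : ℝ, u ≤ a → δ u = γ u := fun u hu => if_pos hu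
  have hδ₂ : ∀ u : ℝ, a ≤ u → δ u = γ a + ((u - a) * s) • (w - γ a) := by
    intro u hu
    rcases hu.eq_or_lt with rfl | hu
    · simp [δ]
    · exact if_neg hu.not_ge
  have ha0 : (0 : ℝ) ≤ a := Nat.cast_nonneg a
  refine ⟨a + 1, a.succ_pos, δ, ?_, ?_, ?_, ?_, ?_⟩
  · have hunion : Set.Icc (0 : ℝ) ((a + 1 : ℕ) : ℝ) =
        Set.Icc 0 (a : ℝ) ∪ Set.Icc (a : ℝ) (a + 1) := by
      rw [Set.Icc_union_Icc_eq_Icc ha0 (by linarith)]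
      push_cast
      rfl
    rw [hunion]
    refine ContinuousOn.union_of_isClosed ?_ ?_ isClosed_Icc isClosed_Icc
    · exact hc.congr fun u hu => hδ₁ u hu.2
    · refine ContinuousOn.congr (f := fun u : ℝ => γ a + ((u - a) * s) • (w - γ a)) ?_
        fun u hu => hδ₂ u hu.1
      fun_prop
  · intro k hk hka
    rcases Nat.le_succ_iff.mp hka with hka | rfl
    · have hka' : (k : ℝ) ≤ a := by exact_mod_cast hka
      have heq : ∀ u ∈ Set.Icc ((k : ℝ) - 1) k, δ u = γ u :=
        fun u hu => hδ₁ u (hu.2.trans hka')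
      have heq₁ : δ ((k : ℝ) - 1) = γ ((k : ℝ) - 1) := hδ₁ _ (by linarith)
      rw [heq₁]
      rcases hd k hk hka with h | ⟨hinj, v, hv, r, hr, h⟩
      · exact Or.inl fun u hu => (heq u hu).trans (h u hu)
      · refine Or.inr ⟨hinj.congr fun u hu => (heq u hu).symm, v, hv, r, hr,
          fun u hu => (heq u hu).trans (h u hu)⟩
    · have hk1 : ((a + 1 : ℕ) : ℝ) - 1 = a := by push_cast; ring
      rw [Nat.succ_eq_add_one, hk1, hδ₁ a le_rfl]
      by_cases hwy : w - γ a = 0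
      · exact Or.inl fun u hu => by rw [hδ₂ u hu.1, hwy, smul_zero, add_zero]
      · refine Or.inr ⟨fun u hu v hv huv => ?_, w, hw, s, hs, fun u hu => hδ₂ u hu.1⟩
        rw [hδ₂ u hu.1, hδ₂ v hv.1] at huv
        have h := mul_right_cancel₀ hs.1.ne' (smul_left_injective ℝ hwy (add_left_cancel huv))
        linarith
  · rw [hδ₁ 0 ha0, h0]
  · intro u hu
    rcases le_total u a with hua | hua
    · rw [hδ₁ u hua]
      exact hin u ⟨hu.1, hua⟩
    · rw [hδ₂ u hua, mul_smul]
      have hu2 := hu.2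
      push_cast at hu2
      have := hU.add_smul_sub_mem (hin a ⟨ha0, le_rfl⟩) hy
        (t := u - a) ⟨by linarith, by linarith⟩
      rwa [add_sub_cancel_left] at this
  · rw [hδ₂ _ (by push_cast; linarith)]
    push_cast
    rw [add_sub_cancel_left, one_mul]

/-- Moving successively towards the vertices `v i`, `i ∈ T`, with suitable step sizes, reaches
the barycentre of `x` with weight `1 - δ` and the `v i` with weights `δ * t i`. -/
theorem barycenter {ι : Type*} {K : Set (EuclideanSpace ℝ (Fin n))} (hK : Convex ℝ K)
    (hWK : W ⊆ K) (hU : Convex ℝ U) {C : ℝ} (hC : ∀ x ∈ K, ∀ z ∈ K, ‖x - z‖ ≤ C)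
    {δ : ℝ} (hδ : 0 < δ) (hδ' : δ ≤ 1 / 2)
    {x : EuclideanSpace ℝ (Fin n)} (hx : DirectedReachable W U q x) (hxK : x ∈ K)
    (hball : ∀ z ∈ K, ‖z - x‖ ≤ 2 * δ * C → z ∈ U)
    (v : ι → EuclideanSpace ℝ (Fin n)) (hv : ∀ i, v i ∈ W) (t : ι → ℝ) (T : Finset ι)
    (ht : ∀ i ∈ T, 0 < t i) (hsum : ∑ i ∈ T, t i ≤ 1) :
    let y := x + (δ / (1 - δ + δ * ∑ i ∈ T, t i)) • ∑ i ∈ T, t i • (v i - x)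
    DirectedReachable W U q y ∧ y ∈ K := by
  classical
  induction T using Finset.induction_on with
  | empty => simpa using ⟨hx, hxK⟩
  | insert i T hi ih =>
    have hti : 0 < t i := ht i (Finset.mem_insert_self i T)
    have htT : ∀ j ∈ T, 0 < t j := fun j hj => ht j (Finset.mem_insert_of_mem hj)
    have hT0 : 0 ≤ ∑ j ∈ T, t j := Finset.sum_nonneg fun j hj => (htT j hj).le
    have hsum' := hsum
    rw [Finset.sum_insert hi] at hsum'
    obtain ⟨hR, hyK⟩ := ih htT (by linarith)
    intro y'
    set D : ℝ := 1 - δ + δ * ∑ j ∈ T, t j with hD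
    set y := x + (δ / D) • ∑ j ∈ T, t j • (v j - x) with hy
    have hδt : 0 < δ * t i := mul_pos hδ hti
    have hDpos : 1 / 2 ≤ D := by
      have := mul_nonneg hδ.le hT0
      linarith
    have hD' : 1 - δ + δ * ∑ j ∈ insert i T, t j = D + δ * t i := by
      rw [Finset.sum_insert hi, hD]
      ring
    have hs : δ * t i / (D + δ * t i) ∈ Set.Ioc (0 : ℝ) 1 :=
      ⟨by positivity, (div_le_one (by positivity)).2 (by linarith)⟩
    have hy' : y' = y + (δ * t i / (D + δ * t i)) • (v i - y) := by
      have hD0 : D ≠ 0 := by positivity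
      have hD1 : D + δ * t i ≠ 0 := by positivity
      simp only [y', hD']
      rw [hy, Finset.sum_insert hi]
      clear_value D
      match_scalars <;> field_simp <;> ring
    have hy'K : y' ∈ K := by
      rw [hy']
      exact hK.add_smul_sub_mem hyK (hWK (hv i)) ⟨hs.1.le, hs.2⟩
    have hC0 : 0 ≤ C := (norm_nonneg _).trans (hC x hxK x hxK)
    have hnorm : ‖∑ j ∈ insert i T, t j • (v j - x)‖ ≤ C := by
      calc ‖∑ j ∈ insert i T, t j • (v j - x)‖
          ≤ ∑ j ∈ insert i T, t j * C := by
            refine norm_sum_le_of_le _ fun j hj => ?_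
            rw [norm_smul, Real.norm_of_nonneg (ht j hj).le]
            exact mul_le_mul_of_nonneg_left (hC _ (hWK (hv j)) x hxK) (ht j hj).le
        _ = (∑ j ∈ insert i T, t j) * C := by rw [Finset.sum_mul]
        _ ≤ C := mul_le_of_le_one_left hC0 hsum
    have hcoef : δ / (D + δ * t i) ≤ 2 * δ := by
      rw [div_le_iff₀ (by positivity)]
      nlinarith
    have hy'U : y' ∈ U := by
      refine hball y' hy'K ?_
      simp only [y', hD', add_sub_cancel_left, norm_smul]
      rw [Real.norm_of_nonneg (by positivity)]
      exact mul_le_mul hcoef hnorm (norm_nonneg _) (by positivity)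
    refine ⟨?_, hy'K⟩
    rw [hy'] at hy'U ⊢
    exact hR.step hU (hv i) hs hy'U

end DirectedReachable

/-- Let `K` be the convex hull of the standard basis vectors
`W = {e_1, …, e_n}` of `ℝ^n`, let `q ∈ K`, let `K'` be the face of `K` spanned by a
nonempty subset `S` of the vertices, and let `q'` be in the relative interior of `K'`.
Then for every `ε > 0` there is a `W`-directed path in `K` from `q` ending within `ε`
of `q'` and staying within distance `ε` of the segment `[q, q']`. -/
theorem stmt6 (n : ℕ) (hn : 1 ≤ n)
    (K : Set (EuclideanSpace ℝ (Fin n)))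
    (hK : K = convexHull ℝ (Set.range (fun i : Fin n => EuclideanSpace.single i (1 : ℝ))))
    (q : EuclideanSpace ℝ (Fin n)) (hq : q ∈ K)
    (S : Finset (Fin n)) (hS : S.Nonempty)
    (t : Fin n → ℝ) (ht : ∀ i ∈ S, 0 < t i) (htsum : ∑ i ∈ S, t i = 1)
    (q' : EuclideanSpace ℝ (Fin n))
    (hq' : q' = ∑ i ∈ S, t i • EuclideanSpace.single i (1 : ℝ))
    (ε : ℝ) (hε : 0 < ε) :
    ∃ a : ℕ, 0 < a ∧ ∃ γ : ℝ → EuclideanSpace ℝ (Fin n),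
      ContinuousOn γ (Set.Icc 0 (a : ℝ)) ∧
      IsEuclidDirectedPath (Set.range (fun i : Fin n => EuclideanSpace.single i (1 : ℝ))) a γ ∧
      γ 0 = q ∧
      (∀ u ∈ Set.Icc (0 : ℝ) (a : ℝ), γ u ∈ K) ∧
      ‖γ (a : ℝ) - q'‖ < ε ∧
      (∀ u ∈ Set.Icc (0 : ℝ) (a : ℝ), ∃ p ∈ segment ℝ q q', ‖γ u - p‖ ≤ ε) := by
  set v : Fin n → EuclideanSpace ℝ (Fin n) := fun i => EuclideanSpace.single i (1 : ℝ) with hv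
  have hKc : Convex ℝ K := hK ▸ convex_convexHull ℝ _
  have hWK : Set.range v ⊆ K := hK ▸ subset_convexHull ℝ _
  have hvK : ∀ i, v i ∈ K := fun i => hWK ⟨i, rfl⟩
  have hK1 : ∀ x ∈ K, ‖x‖ ≤ 1 := by
    have : K ⊆ Metric.closedBall 0 1 := by
      rw [hK]
      refine convexHull_min ?_ (convex_closedBall 0 1)
      rintro _ ⟨i, rfl⟩
      simp [hv]
    exact fun x hx => by simpa using this hx
  have hdiam : ∀ x ∈ K, ∀ z ∈ K, ‖x - z‖ ≤ 2 := fun x hx z hz =>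
    (norm_sub_le x z).trans (by linarith [hK1 x hx, hK1 z hz])
  have hq'K : q' ∈ K := by
    rw [hq']
    exact hKc.sum_mem (fun i hi => (ht i hi).le) htsum fun i _ => hvK i
  let U : Set (EuclideanSpace ℝ (Fin n)) := K ∩ (segment ℝ q q' + Metric.closedBall (0 : EuclideanSpace ℝ (Fin n)) ε)
  have hU : Convex ℝ U := hKc.inter ((convex_segment q q').add (convex_closedBall 0 ε))
  have hmemU : ∀ z ∈ K, ∀ p ∈ segment ℝ q q', ‖z - p‖ ≤ ε → z ∈ U := fun z hz p hp h =>
    ⟨hz, Set.mem_add.2 ⟨p, hp, z - p, by simpa using h, add_sub_cancel _ _⟩⟩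
  obtain ⟨δ, hδ, hδ', hδε⟩ : ∃ δ : ℝ, 0 < δ ∧ δ ≤ 1 / 2 ∧ 2 * δ * 2 ≤ ε :=
    ⟨min (1 / 2) (ε / 4), by positivity, min_le_left _ _,
      by linarith [min_le_right (1 / 2) (ε / 4)]⟩
  have hreach : ∀ m : ℕ,
      DirectedReachable (Set.range v) U q (q' + (1 - δ) ^ m • (q - q')) := by
    intro m
    induction m with
    | zero =>
      rw [pow_zero, one_smul, add_sub_cancel]
      exact .refl (hmemU q hq q (left_mem_segment ℝ q q') (by simpa using hε.le))
    | succ m ih =>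
      have hseg : q' + (1 - δ) ^ m • (q - q') ∈ segment ℝ q q' := by
        rw [segment_symm, segment_eq_image']
        exact ⟨_, ⟨pow_nonneg (by linarith) m, pow_le_one₀ (by linarith) (by linarith)⟩, rfl⟩
      have hxK := hKc.segment_subset hq hq'K hseg
      have h := (DirectedReachable.barycenter hKc hWK hU hdiam hδ hδ' ih hxK
        (fun z hz hzx => hmemU z hz _ hseg (hzx.trans hδε)) v (fun i => ⟨i, rfl⟩) t S ht
        htsum.le).1
      simp only [smul_sub, Finset.sum_sub_distrib, ← Finset.sum_smul, htsum] at h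
      rw [← hq'] at h
      convert h using 1
      match_scalars <;> ring
  have hlim : Filter.Tendsto (fun m : ℕ => ‖(1 - δ) ^ m • (q - q')‖) Filter.atTop (nhds 0) := by
    have := ((tendsto_pow_atTop_nhds_zero_of_lt_one (r := 1 - δ) (by linarith)
      (by linarith)).smul_const (q - q')).norm
    simpa only [zero_smul, norm_zero] using this
  obtain ⟨m, hm⟩ := (hlim.eventually (gt_mem_nhds hε)).exists
  obtain ⟨a, ha, γ, hc, hd, h0, hin, hend⟩ := hreach m
  refine ⟨a, ha, γ, hc, hd, h0, fun u hu => (hin u hu).1, ?_, fun u hu => ?_⟩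
  · rwa [hend, add_sub_cancel_left]
  · obtain ⟨p, hp, b, hb, hpb⟩ := Set.mem_add.1 (hin u hu).2
    exact ⟨p, hp, by simpa [← hpb] using hb⟩
end

section
/- Let n ≥ 1, let x ∈ ℝ^n be a nonzero vector with all coordinates nonnegative, and let e_i be a standard basis vector. Then: (a) the function t ↦ angle(x + t·e_i, e_i) is nonincreasing for t ≥ 0, i.e. for all 0 ≤ t ≤ t' one has angle(x + t'·e_i, e_i) ≤ angle(x + t·e_i, e_i) (so the segment from x to x + e_i radially projects onto an initial subsegment of the spherical geodesic from x/‖x‖ toward e_i); and (b) if moreover ‖x‖ ≥ 1, then angle(x, x + e_i) ≤ arcsin(1/‖x‖). -/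
open InnerProductGeometry

section

variable {V : Type*} [NormedAddCommGroup V] [InnerProductSpace ℝ V]

/-- Moving a vector in the direction `v` does not increase its angle with `v`. -/
theorem angle_add_smul_le_angle {y v : V} (hv : v ≠ 0) {s : ℝ} (hs : 0 ≤ s) :
    angle (y + s • v) v ≤ angle y v := by
  rcases hs.eq_or_lt with rfl | hs
  · simp
  · have h := angle_eq_angle_add_add_angle_add y (smul_ne_zero hs.ne' hv)
    rw [angle_smul_right_of_pos _ _ hs, angle_smul_left_of_pos _ _ hs,
      angle_comm v (y + s • v)] at h
    linarith [angle_nonneg y (y + s • v)]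

theorem sin_angle_add_mul_norm_le (x v : V) :
    Real.sin (angle x (x + v)) * ‖x‖ ≤ ‖v‖ := by
  have h := sin_angle_mul_norm_eq_sin_angle_mul_norm x (x + v)
  rw [sub_add_cancel_left, norm_neg] at h
  rw [h]
  exact mul_le_of_le_one_left (norm_nonneg v) (Real.sin_le_one _)

theorem angle_add_le_arcsin {x v : V} (hx : x ≠ 0) (hxv : 0 ≤ inner ℝ x v) :
    angle x (x + v) ≤ Real.arcsin (‖v‖ / ‖x‖) := by
  have hangle : angle x (x + v) ≤ Real.pi / 2 := by
    rw [angle, Real.arccos_le_pi_div_two, inner_add_right]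
    have := real_inner_self_nonneg (x := x)
    positivity
  rw [← Real.arcsin_sin (by linarith [angle_nonneg x (x + v), Real.pi_pos]) hangle]
  apply Real.monotone_arcsin
  rw [le_div_iff₀ (norm_pos_iff.mpr hx)]
  exact sin_angle_add_mul_norm_le x v

end

/-- Let `x ∈ ℝ^n` be nonzero with nonnegative coordinates and let `e_i` be a
standard basis vector.  Then (a) `t ↦ angle (x + t • e_i) e_i` is nonincreasing for
`t ≥ 0` (so the segment from `x` to `x + e_i` radially projects to an initial subsegment
of the spherical geodesic from `x/‖x‖` toward `e_i`), and (b) if `‖x‖ ≥ 1` then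
`angle x (x + e_i) ≤ arcsin (1/‖x‖)`. -/
theorem stmt7 (n : ℕ) (hn : 1 ≤ n)
    (x : EuclideanSpace ℝ (Fin n)) (hx : x ≠ 0) (hxc : ∀ j, 0 ≤ x j) (i : Fin n) :
    (∀ t t' : ℝ, 0 ≤ t → t ≤ t' →
      angle (x + t' • EuclideanSpace.single i (1 : ℝ)) (EuclideanSpace.single i (1 : ℝ)) ≤
        angle (x + t • EuclideanSpace.single i (1 : ℝ)) (EuclideanSpace.single i (1 : ℝ))) ∧
    (1 ≤ ‖x‖ →
      angle x (x + EuclideanSpace.single i (1 : ℝ)) ≤ Real.arcsin (1 / ‖x‖)) := by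
  have he : EuclideanSpace.single i (1 : ℝ) ≠ 0 := by simp
  refine ⟨fun t t' _ htt' => ?_, fun _ => ?_⟩
  · have h := angle_add_smul_le_angle (y := x + t • EuclideanSpace.single i (1 : ℝ)) he
      (sub_nonneg.mpr htt')
    rwa [add_assoc, ← add_smul, add_sub_cancel] at h
  · simpa using angle_add_le_arcsin (v := EuclideanSpace.single i (1 : ℝ)) hx
      (by simpa [EuclideanSpace.inner_single_right] using hxc i)
end

section
/- Let a, a', w, b be unit vectors in a real inner product space such that: all pairwise angles among a, a', w, b are at most π/2; angle(a, a') + angle(a', w) = angle(a, w) (i.e. a' lies on the spherical geodesic segment from a to w); angle(b, w) < angle(a', w); and angle(a', w) < angle(a, w). Then angle(b, a') < angle(b, a). -/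
open InnerProductGeometry Real

/-- Let `a, a', w, b` be unit vectors in a real inner product space with all
pairwise angles at most `π/2`, such that `a'` lies on the spherical geodesic segment from
`a` to `w` (i.e. `angle a a' + angle a' w = angle a w`), with `angle b w < angle a' w` and
`angle a' w < angle a w`.  Then `angle b a' < angle b a`. -/
theorem stmt9 {E : Type*} [NormedAddCommGroup E] [InnerProductSpace ℝ E]
    (a a' w b : E)
    (ha : ‖a‖ = 1) (ha' : ‖a'‖ = 1) (hw : ‖w‖ = 1) (hb : ‖b‖ = 1)
    (haa' : angle a a' ≤ π / 2)
    (haw : angle a w ≤ π / 2)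
    (hab : angle a b ≤ π / 2)
    (ha'w : angle a' w ≤ π / 2)
    (ha'b : angle a' b ≤ π / 2)
    (hbw : angle b w ≤ π / 2)
    (hgeo : angle a a' + angle a' w = angle a w)
    (h1 : angle b w < angle a' w)
    (h2 : angle a' w < angle a w) :
    angle b a' < angle b a := by
  have inner_eq_cos {x y : E} (hx : ‖x‖ = 1) (hy : ‖y‖ = 1) :
      inner ℝ x y = Real.cos (angle x y) := by
    rw [cos_angle, hx, hy, mul_one, div_one]
  have cos_lt {x y u v : E} (hx : ‖x‖ = 1) (hy : ‖y‖ = 1) (hu : ‖u‖ = 1) (hv : ‖v‖ = 1)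
      (h : angle x y < angle u v) : inner ℝ u v < (inner ℝ x y : ℝ) := by
    rw [inner_eq_cos hu hv, inner_eq_cos hx hy]
    exact Real.cos_lt_cos_of_nonneg_of_le_pi (angle_nonneg _ _) (angle_le_pi _ _) h
  have inner_nonneg {x y : E} (hx : ‖x‖ = 1) (hy : ‖y‖ = 1) (h : angle x y ≤ π / 2) :
      0 ≤ (inner ℝ x y : ℝ) := by
    rw [inner_eq_cos hx hy]
    exact Real.cos_nonneg_of_neg_pi_div_two_le_of_le
      (by linarith [angle_nonneg x y, Real.pi_pos]) h
  have ha'0 : a' ≠ 0 := by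
    rintro rfl
    simp at ha'
  have hmem := ((angle_eq_angle_add_angle_iff ha'0).mp hgeo.symm).resolve_left
    (by linarith [Real.pi_pos])
  obtain ⟨p, q, hpq⟩ := Submodule.mem_span_pair.mp hmem
  have hp : (0 : ℝ) ≤ p := p.2
  have hq : (0 : ℝ) ≤ q := q.2
  have hpq' : a' = (p : ℝ) • a + (q : ℝ) • w := hpq.symm
  generalize (p : ℝ) = r at hp hpq'
  generalize (q : ℝ) = s at hq hpq'
  have expand (v : E) : inner ℝ a' v = r * inner ℝ a v + s * inner ℝ w v := by
    rw [hpq', inner_add_left, real_inner_smul_left, real_inner_smul_left]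
  have ea := expand a
  have ew := expand w
  have ea' := expand a'
  have eb := expand b
  have hlt1 := cos_lt hb hw ha' hw h1
  have hlt2 := cos_lt ha' hw ha hw h2
  have hc := inner_nonneg ha hw haw
  have hx1 : inner ℝ a b ≤ (1 : ℝ) := by
    simpa [ha, hb] using real_inner_le_norm a b
  have haa1 : inner ℝ a' a ≤ (1 : ℝ) := by
    simpa [ha, ha'] using real_inner_le_norm a' a
  rw [real_inner_self_eq_norm_sq, ha] at ea
  rw [real_inner_self_eq_norm_sq, hw] at ew
  rw [real_inner_self_eq_norm_sq, ha', real_inner_comm a' a, real_inner_comm a' w] at ea'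
  rw [real_inner_comm a w] at ea
  rw [real_inner_comm b w] at eb
  have hs : 0 < s := by
    refine lt_of_le_of_ne hq fun h => ?_
    subst h
    nlinarith
  have hr1 : r ≤ 1 := by
    nlinarith [mul_nonneg hp (mul_nonneg hq hc), mul_nonneg hq hc]
  have key : inner ℝ a b < (inner ℝ a' b : ℝ) := by
    have k1 := mul_lt_mul_of_pos_left hlt1 hs
    have k2 := mul_le_mul_of_nonneg_left haa1 hp
    have k3 := mul_le_mul_of_nonneg_left hx1 (sub_nonneg.mpr hr1)
    linarith
  by_contra! hle
  rw [angle_comm b a, angle_comm b a'] at hle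
  have := Real.cos_le_cos_of_nonneg_of_le_pi (angle_nonneg _ _) (angle_le_pi _ _) hle
  rw [← inner_eq_cos ha hb, ← inner_eq_cos ha' hb] at this
  linarith
end

section
/- Let n ≥ 2 and let q, q' ∈ ℝ^n be unit vectors with all coordinates nonnegative, with q ≠ e_n and q' ≠ e_n, and suppose angle(e_n, q) = angle(e_n, q'). Let P : ℝ^n → ℝ^n be the orthogonal projection onto the span of e_1,…,e_{n−1}. Then P q ≠ 0, P q' ≠ 0, and angle(q, q') ≤ angle(P q, P q'). -/
open InnerProductGeometry

/-- For unit vectors `x`, `y` having the same inner product with a unit vector `e`, projecting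
onto the orthogonal complement of `e` does not decrease the angle. -/
theorem angle_le_angle_sub_inner_smul {E : Type*} [NormedAddCommGroup E] [InnerProductSpace ℝ E]
    {e x y : E} (he : ‖e‖ = 1) (hx : ‖x‖ = 1) (hy : ‖y‖ = 1) (h : inner ℝ e x = inner ℝ e y)
    (hx0 : x - inner ℝ e x • e ≠ 0) :
    angle x y ≤ angle (x - inner ℝ e x • e) (y - inner ℝ e y • e) := by
  have hinner (z w : E) : inner ℝ (z - inner ℝ e z • e) (w - inner ℝ e w • e)
      = inner ℝ z w - inner ℝ e z * inner ℝ e w := by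
    simp only [inner_sub_left, inner_sub_right, real_inner_smul_left, real_inner_smul_right,
      real_inner_self_eq_norm_sq, he, real_inner_comm e z]
    ring
  have hnx : ‖x - inner ℝ e x • e‖ ^ 2 = 1 - inner ℝ e x ^ 2 := by
    rw [← real_inner_self_eq_norm_sq, hinner, real_inner_self_eq_norm_sq, hx]
    ring
  have hny : ‖y - inner ℝ e y • e‖ ^ 2 = 1 - inner ℝ e x ^ 2 := by
    rw [← real_inner_self_eq_norm_sq, hinner, real_inner_self_eq_norm_sq, hy, h]
    ring
  have hnorm : ‖y - inner ℝ e y • e‖ = ‖x - inner ℝ e x • e‖ :=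
    (sq_eq_sq₀ (norm_nonneg _) (norm_nonneg _)).1 (hny.trans hnx.symm)
  have hpos : 0 < 1 - inner ℝ e x ^ 2 := hnx ▸ pow_pos (norm_pos_iff.2 hx0) 2
  have hxy : inner ℝ x y ≤ 1 := by simpa [hx, hy] using real_inner_le_norm x y
  refine Real.arccos_le_arccos ?_
  rw [hnorm, ← sq, hnx, hinner, ← h, hx, hy, mul_one, div_one, div_le_iff₀ hpos]
  nlinarith [mul_nonneg (sq_nonneg (inner ℝ e x)) (sub_nonneg.2 hxy)]

/-- A unit vector `x ≠ e` with `0 ≤ ⟪e, x⟫` has nonzero component orthogonal to the unit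
vector `e`. -/
theorem sub_inner_smul_ne_zero {E : Type*} [NormedAddCommGroup E] [InnerProductSpace ℝ E]
    {e x : E} (he : ‖e‖ = 1) (hx : ‖x‖ = 1) (hnonneg : 0 ≤ inner ℝ e x) (hne : x ≠ e) :
    x - inner ℝ e x • e ≠ 0 := by
  intro h0
  have hxe := sub_eq_zero.1 h0
  have hone : inner ℝ e x = 1 := by
    have := congrArg norm hxe
    rwa [hx, norm_smul, he, mul_one, Real.norm_of_nonneg hnonneg, eq_comm] at this
  exact hne (by rwa [hone, one_smul] at hxe)

/-- Let `q, q' ∈ ℝ^n` (`n ≥ 2`) be nonnegative unit vectors, both distinct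
from the last basis vector `e_n`, equidistant (in angle) from `e_n`.  Let `P` be the
orthogonal projection onto the span of `e_1, …, e_{n-1}`.  Then `P q ≠ 0`, `P q' ≠ 0`,
and `angle q q' ≤ angle (P q) (P q')`. -/
theorem stmt11 (n : ℕ) (hn : 2 ≤ n)
    (en : Fin n) (hen : (en : ℕ) = n - 1)
    (q q' : EuclideanSpace ℝ (Fin n))
    (hq : ‖q‖ = 1) (hqc : ∀ i, 0 ≤ q i) (hqe : q ≠ EuclideanSpace.single en (1 : ℝ))
    (hq' : ‖q'‖ = 1) (hq'c : ∀ i, 0 ≤ q' i)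
    (hq'e : q' ≠ EuclideanSpace.single en (1 : ℝ))
    (hang : angle (EuclideanSpace.single en (1 : ℝ)) q
          = angle (EuclideanSpace.single en (1 : ℝ)) q')
    (P : EuclideanSpace ℝ (Fin n) → EuclideanSpace ℝ (Fin n))
    (hP : ∀ x : EuclideanSpace ℝ (Fin n), ∀ j : Fin n,
      P x j = if j = en then 0 else x j) :
    P q ≠ 0 ∧ P q' ≠ 0 ∧ angle q q' ≤ angle (P q) (P q') := by
  set e : EuclideanSpace ℝ (Fin n) := EuclideanSpace.single en 1 with he_def
  have he : ‖e‖ = 1 := by simp [he_def]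
  have hcoord (x : EuclideanSpace ℝ (Fin n)) : inner ℝ e x = x en := by
    simp [he_def, EuclideanSpace.inner_single_left]
  have hproj (x : EuclideanSpace ℝ (Fin n)) : P x = x - inner ℝ e x • e := by
    ext j
    rw [hP, hcoord]
    by_cases hj : j = en <;> simp [he_def, hj]
  have hinner : inner ℝ e q = inner ℝ e q' := by
    have := congrArg Real.cos hang
    simpa [cos_angle, he, hq, hq'] using this
  have hq0 := sub_inner_smul_ne_zero he hq (by rw [hcoord]; exact hqc en) hqe
  have hq'0 := sub_inner_smul_ne_zero he hq' (by rw [hcoord]; exact hq'c en) hq'e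
  rw [hproj, hproj]
  exact ⟨hq0, hq'0, angle_le_angle_sub_inner_smul he hq hq' hinner hq0⟩
end

section
/- Let n ≥ 1. For every ε > 0 there exists R > 0 such that for every x ∈ ℝ^n with all coordinates strictly positive and ‖x‖ > R, there exists an (infinite) walk c : [0,∞) → ℝ^n over V = {e_1,…,e_n} with c(0) = x such that angle(c(t), x) < ε for all t ≥ 0. -/
open InnerProductGeometry

/-- The piecewise affine interpolation of a sequence whose increments lie in `v` is a walk. -/
theorem isWalk_interpolation {n m : ℕ} (v : Fin m → EuclideanSpace ℝ (Fin n))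
    (f : ℕ → EuclideanSpace ℝ (Fin n)) (j : ℕ → Fin m) (hf : ∀ k, f (k + 1) = f k + v (j k)) :
    IsWalk v (fun t => f ⌊t⌋₊ + (t - (⌊t⌋₊ : ℝ)) • v (j ⌊t⌋₊)) := by
  refine ⟨j, fun k t ht => ?_⟩
  simp only [Nat.floor_natCast, sub_self, zero_smul, add_zero]
  rcases ht.2.lt_or_eq with h | h
  · have : ⌊t⌋₊ = k := (Nat.floor_eq_iff (k.cast_nonneg.trans ht.1)).2 ⟨ht.1, h⟩
    rw [this]
  · have : ⌊t⌋₊ = k + 1 := by rw [h]; exact_mod_cast Nat.floor_natCast (R := ℝ) (k + 1)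
    rw [this, h, hf]
    simp

/-- A lattice path in the standard basis directions can follow the ray through a positive
vector `x` at bounded coordinatewise distance. -/
theorem exists_path_near_ray {n : ℕ} (hn : 1 ≤ n) (x : EuclideanSpace ℝ (Fin n))
    (hx : ∀ i, 0 < x i) :
    ∃ (j : ℕ → Fin n) (f : ℕ → EuclideanSpace ℝ (Fin n)), f 0 = x ∧
      (∀ k, f (k + 1) = f k + EuclideanSpace.single (j k) (1 : ℝ)) ∧
      ∀ k i, |f k i - (1 + k / ∑ l, x l) * x i| ≤ n := by
  set S := ∑ l, x l with hS
  have : Nonempty (Fin n) := ⟨⟨0, hn⟩⟩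
  have hS0 : 0 < S := Finset.sum_pos (fun i _ => hx i) Finset.univ_nonempty
  have hray : ∀ r : ℝ, ∑ i, (1 + r / S) * x i = S + r := fun r => by
    rw [← Finset.mul_sum, ← hS]; field_simp
  have hstep : ∀ (k : ℕ) (z : EuclideanSpace ℝ (Fin n)), ∃ i,
      ∑ l, z l = S + k → z i ≤ (1 + ((k + 1 : ℕ) : ℝ) / S) * x i := by
    intro k z
    by_contra! h
    have hlt := Finset.sum_lt_sum_of_nonempty (Finset.univ_nonempty (α := Fin n))
      (fun i _ => (h i).2)
    rw [hray, (h (Classical.arbitrary _)).1] at hlt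
    push_cast at hlt
    linarith
  choose g hg using hstep
  let f : ℕ → EuclideanSpace ℝ (Fin n) :=
    Nat.rec x (fun k z => z + EuclideanSpace.single (g k z) (1 : ℝ))
  have hf : ∀ k, f (k + 1) = f k + EuclideanSpace.single (g k (f k)) (1 : ℝ) := fun _ => rfl
  have hsum : ∀ k : ℕ, ∑ l, f k l = S + k := by
    intro k
    induction k with
    | zero => simp [f, hS]
    | succ k ih =>
      simp only [hf, PiLp.add_apply, Finset.sum_add_distrib, ih]
      simp [add_assoc]
  have hle : ∀ (k : ℕ) i, f k i - (1 + k / S) * x i ≤ 1 := by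
    intro k
    induction k with
    | zero => simp [f]
    | succ k ih =>
      intro i
      rw [hf, PiLp.add_apply]
      by_cases hi : i = g k (f k)
      · have := hg k (f k) (hsum k)
        rw [← hi] at this ⊢
        simp only [PiLp.single_apply, if_true]
        linarith
      · have hmono : (1 + (k : ℝ) / S) * x i ≤ (1 + ((k + 1 : ℕ) : ℝ) / S) * x i := by
          have := (hx i).le
          gcongr
          simp
        have := ih i
        simp only [PiLp.single_apply, if_neg hi]
        linarith
  refine ⟨fun k => g k (f k), f, rfl, hf, fun k i => abs_le.2 ⟨?_, ?_⟩⟩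
  · have h := Finset.single_le_sum (f := fun i => 1 - (f k i - (1 + k / S) * x i))
      (fun i _ => sub_nonneg.2 (hle k i)) (Finset.mem_univ i)
    simp only [Finset.sum_sub_distrib, hray, hsum] at h
    simp only [Finset.sum_const, Finset.card_univ, Fintype.card_fin, nsmul_eq_mul] at h
    linarith
  · exact (hle k i).trans (Nat.one_le_cast.2 hn)

/-- A crude comparison of the Euclidean norm with the supremum norm. -/
theorem EuclideanSpace.norm_le_card_sq {n : ℕ} (e : EuclideanSpace ℝ (Fin n))
    (he : ∀ i, |e i| ≤ n) : ‖e‖ ≤ (n : ℝ) ^ 2 := by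
  rcases n.eq_zero_or_pos with rfl | hn
  · simp [Subsingleton.elim e 0]
  refine (sq_le_sq₀ (norm_nonneg _) (by positivity)).1 ?_
  rw [EuclideanSpace.real_norm_sq_eq]
  have h1 : (1 : ℝ) ≤ n := by exact_mod_cast hn
  calc ∑ i, e i ^ 2 ≤ ∑ _i : Fin n, (n : ℝ) ^ 2 :=
        Finset.sum_le_sum fun i _ => sq_le_sq' (abs_le.1 (he i)).1 (abs_le.1 (he i)).2
    _ = (n : ℝ) ^ 3 := by simp; ring
    _ ≤ (n : ℝ) ^ 4 := pow_le_pow_right₀ h1 (by norm_num)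
    _ = ((n : ℝ) ^ 2) ^ 2 := by ring

/-- Perturbing a long vector, or a longer multiple of it, by a bounded amount changes its
direction by little. -/
theorem exists_angle_smul_add_lt (E : Type*) [NormedAddCommGroup E] [InnerProductSpace ℝ E]
    {K ε : ℝ} (hK : 0 ≤ K) (hε : 0 < ε) :
    ∃ R : ℝ, 0 < R ∧ ∀ (x e : E) (a : ℝ), R < ‖x‖ → 1 ≤ a → ‖e‖ ≤ K →
      angle (a • x + e) x < ε := by
  set η := min ε Real.pi
  have hη : 0 < η := lt_min hε Real.pi_pos
  have hηpi : η ≤ Real.pi := min_le_right _ _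
  have hcos : Real.cos η < 1 := by
    simpa using Real.cos_lt_cos_of_nonneg_of_le_pi le_rfl hηpi hη
  set δ := 1 - Real.cos η with hδ
  have hδ0 : 0 < δ := sub_pos.2 hcos
  refine ⟨2 * K / δ + K + 1, by positivity, fun x e a hx ha he => ?_⟩
  have hdiv : 0 ≤ 2 * K / δ := by positivity
  have hx0 : 0 < ‖x‖ := by linarith
  have hax : ‖x‖ ≤ a * ‖x‖ := le_mul_of_one_le_left hx0.le ha
  have hinner : (a * ‖x‖ - K) * ‖x‖ ≤ inner ℝ (a • x + e) x := by
    rw [inner_add_left, real_inner_smul_left, real_inner_self_eq_norm_sq]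
    have h1 := (abs_le.1 (abs_real_inner_le_norm e x)).1
    have h2 : ‖e‖ * ‖x‖ ≤ K * ‖x‖ := by gcongr
    nlinarith
  have hnorm : ‖a • x + e‖ ≤ a * ‖x‖ + K := by
    refine (norm_add_le _ _).trans ?_
    rw [norm_smul, Real.norm_of_nonneg (by linarith)]
    gcongr
  have hy : 0 < ‖a • x + e‖ := by
    refine norm_pos_iff.2 fun h => ?_
    rw [h, inner_zero_left] at hinner
    nlinarith
  refine lt_of_lt_of_le ?_ (min_le_left ε Real.pi)
  change angle (a • x + e) x < η
  by_contra! hle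
  have hc := Real.cos_le_cos_of_nonneg_of_le_pi hη.le (angle_le_pi (a • x + e) x) hle
  rw [cos_angle, div_le_iff₀ (by positivity)] at hc
  have hlow : a * ‖x‖ - K ≤ (1 - δ) * ‖a • x + e‖ := by
    refine le_of_mul_le_mul_right ?_ hx0
    have : Real.cos η = 1 - δ := by rw [hδ]; ring
    rw [this] at hc
    linarith
  have hδx : 2 * K < δ * (a * ‖x‖) := by
    have : 2 * K / δ < a * ‖x‖ := by linarith
    rwa [div_lt_iff₀' hδ0] at this
  have hpos : 0 < 1 - δ := by
    by_contra! h
    nlinarith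
  have hup : (1 - δ) * ‖a • x + e‖ ≤ (1 - δ) * (a * ‖x‖ + K) := by gcongr
  nlinarith

/-- For every `ε > 0` there is `R > 0` such that every `x ∈ ℝ^n` with all
coordinates strictly positive and `‖x‖ > R` is the starting point of an infinite walk
over the standard basis vectors staying within angle `ε` of `x`. -/
theorem stmt12 (n : ℕ) (hn : 1 ≤ n) (ε : ℝ) (hε : 0 < ε) :
    ∃ R : ℝ, 0 < R ∧
      ∀ x : EuclideanSpace ℝ (Fin n), (∀ i, 0 < x i) → R < ‖x‖ →
        ∃ c : ℝ → EuclideanSpace ℝ (Fin n),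
          IsWalk (fun i : Fin n => EuclideanSpace.single i (1 : ℝ)) c ∧
          c 0 = x ∧
          ∀ t : ℝ, 0 ≤ t → angle (c t) x < ε := by
  obtain ⟨R, hR, hangle⟩ :=
    exists_angle_smul_add_lt (EuclideanSpace ℝ (Fin n)) (sq_nonneg (n : ℝ)) hε
  refine ⟨R, hR, fun x hx hRx => ?_⟩
  obtain ⟨j, f, hf0, hf, hdist⟩ := exists_path_near_ray hn x hx
  refine ⟨_, isWalk_interpolation _ f j hf, by simp [hf0], fun t ht => ?_⟩
  have hS : 0 ≤ ∑ l, x l := Finset.sum_nonneg fun i _ => (hx i).le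
  set k := ⌊t⌋₊
  set s := t - (k : ℝ) with hs
  have hs0 : 0 ≤ s := sub_nonneg.2 (Nat.floor_le ht)
  have hs1 : s ≤ 1 := by have := Nat.lt_floor_add_one t; linarith
  set y := f k + s • EuclideanSpace.single (j k) (1 : ℝ) with hy
  have hconv : y = (1 - s) • f k + s • f (k + 1) := by rw [hy, hf]; module
  have hmain := hangle x (y - (1 + t / ∑ l, x l) • x) (1 + t / ∑ l, x l) hRx
    (by have : 0 ≤ t / ∑ l, x l := by positivity
        linarith)
    (EuclideanSpace.norm_le_card_sq _ fun i => ?_)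
  · rwa [add_sub_cancel] at hmain
  · have hsplit : (y - (1 + t / ∑ l, x l) • x) i =
        (1 - s) * (f k i - (1 + k / ∑ l, x l) * x i) +
          s * (f (k + 1) i - (1 + ((k + 1 : ℕ) : ℝ) / ∑ l, x l) * x i) := by
      have ht' : t = k + s := by rw [hs]; ring
      rw [hconv, ht']
      simp only [PiLp.sub_apply, PiLp.add_apply, PiLp.smul_apply, smul_eq_mul]
      push_cast
      ring
    rw [hsplit]
    exact abs_le.2 (convex_Icc (-(n : ℝ)) n (abs_le.1 (hdist k i)) (abs_le.1 (hdist (k + 1) i))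
      (sub_nonneg.2 hs1) hs0 (by ring))
end

section
/- Let n ≥ 1 and let L ⊂ ℝ^n be the set of unit vectors with all coordinates nonnegative. Let Z ⊆ L be compact and connected, and fix q ∈ Z. Then for every δ > 0 there exists a continuous path γ : [0,1] → ℝ^n with γ(0) = γ(1) = q, whose image is contained in the open δ-neighborhood of Z intersected with L, and such that every point of Z lies within distance δ of some point of the image of γ. Consequently, concatenating such loops for δ = 1, 1/2, 1/3, … yields a continuous path γ : [0,∞) → L with Z = ∩_{T>0} closure(γ([T,∞))). -/
open Set Filter Topology

/-- A finite subset of the path component of `q` in `U` lies on a single loop at `q` in `U`. -/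
theorem Set.Finite.exists_loop_through {X : Type*} [TopologicalSpace X] {U S : Set X} {q : X}
    (hS : S.Finite) (hq : q ∈ U) (h : ∀ x ∈ S, JoinedIn U q x) :
    ∃ γ : Path q q, range γ ⊆ U ∧ S ⊆ range γ := by
  induction S, hS using Set.Finite.induction_on with
  | empty => exact ⟨Path.refl q, by simpa using hq, empty_subset _⟩
  | @insert x s _ _ ih =>
    obtain ⟨γ, hγU, hγS⟩ := ih fun y hy => h y (mem_insert_of_mem x hy)
    obtain ⟨η, hη⟩ := h x (mem_insert x s)
    refine ⟨γ.trans (η.trans η.symm), ?_, ?_⟩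
    · simp only [Path.trans_range, Path.symm_range, union_self]
      exact union_subset hγU (range_subset_iff.2 hη)
    · simp only [Path.trans_range, Path.symm_range, union_self]
      exact insert_subset (Or.inr ⟨1, η.target⟩) (hγS.trans subset_union_left)

/-- If nearby points of a compact preconnected set `Z` can be joined inside `U`, then some loop in
`U` passes near every point of `Z`. -/
theorem IsCompact.exists_loop_near {X : Type*} [PseudoMetricSpace X] {Z U : Set X} {q : X}
    (hZ : IsCompact Z) (hZ' : IsPreconnected Z) (hq : q ∈ Z) (hZU : Z ⊆ U)
    (h : ∀ x ∈ Z, ∀ᶠ y in 𝓝[Z] x, JoinedIn U x y) {δ : ℝ} (hδ : 0 < δ) :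
    ∃ γ : Path q q, range γ ⊆ U ∧ ∀ z ∈ Z, ∃ t, dist (γ t) z < δ := by
  obtain ⟨S, hSZ, hS, hcov⟩ := hZ.finite_cover_balls hδ
  obtain ⟨γ, hγU, hγS⟩ := hS.exists_loop_through (hZU hq) fun x hx =>
    hZ'.induction₂ (JoinedIn U) h (fun _ _ _ _ _ _ => JoinedIn.trans)
      (fun _ _ _ _ => JoinedIn.symm) hq (hSZ hx)
  refine ⟨γ, hγU, fun z hz => ?_⟩
  obtain ⟨x, hx, hzx⟩ := mem_iUnion₂.1 (hcov hz)
  obtain ⟨t, rfl⟩ := hγS hx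
  exact ⟨t, by rwa [dist_comm]⟩

theorem norm_inv_norm_smul_sub_lt {E : Type*} [NormedAddCommGroup E] [NormedSpace ℝ E]
    {x p : E} {δ : ℝ} (hx : ‖x‖ = 1) (hp : p ≠ 0) (h : ‖p - x‖ < δ) :
    ‖‖p‖⁻¹ • p - x‖ < 2 * δ := by
  have hp' : ‖p‖ ≠ 0 := norm_ne_zero_iff.2 hp
  have h1 : ‖‖p‖⁻¹ • p - p‖ = |‖x‖ - ‖p‖| := by
    have : ‖p‖⁻¹ • p - p = (‖p‖⁻¹ - 1) • p := by rw [sub_smul, one_smul]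
    rw [this, norm_smul, Real.norm_eq_abs, ← abs_norm p, ← abs_mul, abs_norm, hx, sub_mul,
      inv_mul_cancel₀ hp', one_mul]
  have h2 : |‖x‖ - ‖p‖| ≤ ‖p - x‖ := by
    rw [norm_sub_rev]; exact abs_norm_sub_norm_le x p
  calc ‖‖p‖⁻¹ • p - x‖ ≤ ‖‖p‖⁻¹ • p - p‖ + ‖p - x‖ := norm_sub_le_norm_sub_add_norm_sub _ _ _
    _ < 2 * δ := by linarith

/-- Two points of the spherical simplex at distance less than `δ ≤ 1` are joined inside the
simplex by a path staying within `2 * δ` of the first one. -/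
theorem joinedIn_nonneg_sphere_inter_ball {ι : Type*} [Fintype ι] {x y : EuclideanSpace ℝ ι}
    {δ : ℝ} (hδ : δ ≤ 1) (hx : ‖x‖ = 1) (hx0 : ∀ i, 0 ≤ x i) (hy : ‖y‖ = 1) (hy0 : ∀ i, 0 ≤ y i)
    (hxy : ‖y - x‖ < δ) :
    JoinedIn ({p | ‖p‖ = 1 ∧ ∀ i, 0 ≤ p i} ∩ Metric.ball x (2 * δ)) x y := by
  let f : ℝ → EuclideanSpace ℝ ι := fun t => x + t • (y - x)
  have hf : ∀ t ∈ Icc (0 : ℝ) 1, ‖f t - x‖ < δ := fun t ht => by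
    have : ‖f t - x‖ = t * ‖y - x‖ := by
      simp [f, norm_smul, abs_of_nonneg ht.1]
    rw [this]
    exact (mul_le_of_le_one_left (norm_nonneg _) ht.2).trans_lt hxy
  have hf0 : ∀ t ∈ Icc (0 : ℝ) 1, f t ≠ 0 := fun t ht h0 => by
    have := hf t ht
    rw [h0, zero_sub, norm_neg, hx] at this
    linarith
  have hfc : Continuous f := by fun_prop
  refine JoinedIn.ofLine (f := fun t => ‖f t‖⁻¹ • f t) ?_ (by simp [f, hx]) (by simp [f, hy]) ?_
  · exact (hfc.norm.continuousOn.inv₀ fun t ht => norm_ne_zero_iff.2 (hf0 t ht)).smul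
      hfc.continuousOn
  · rintro _ ⟨t, ht, rfl⟩
    refine ⟨⟨norm_smul_inv_norm (𝕜 := ℝ) (hf0 t ht), fun i => ?_⟩, ?_⟩
    · have : f t i = (1 - t) * x i + t * y i := by simp [f]; ring
      have h1 : 0 ≤ f t i := by
        rw [this]
        exact add_nonneg (mul_nonneg (sub_nonneg.2 ht.2) (hx0 i)) (mul_nonneg ht.1 (hy0 i))
      simpa using mul_nonneg (inv_nonneg.2 (norm_nonneg (f t))) h1
    · rw [mem_ball_iff_norm]
      exact norm_inv_norm_smul_sub_lt hx (hf0 t ht) (hf t ht)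

/-- A sequence of loops at `q`, parametrized by `[0, 1]`, traversed one after another. -/
noncomputable def concatLoops {X : Type*} (g : ℕ → ℝ → X) (t : ℝ) : X :=
  g ⌊t⌋₊ (t - ⌊t⌋₊)

theorem concatLoops_of_mem_Icc {X : Type*} {g : ℕ → ℝ → X} {q : X} (h0 : ∀ k, g k 0 = q)
    (h1 : ∀ k, g k 1 = q) {k : ℕ} {t : ℝ} (ht : t ∈ Icc (k : ℝ) (k + 1)) :
    concatLoops g t = g k (t - k) := by
  rcases ht.2.lt_or_eq with hlt | rfl
  · rw [concatLoops, (Nat.floor_eq_iff (k.cast_nonneg.trans ht.1)).2 ⟨ht.1, hlt⟩]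
  · have : ⌊(k : ℝ) + 1⌋₊ = k + 1 := by exact_mod_cast Nat.floor_natCast (R := ℝ) (k + 1)
    simp [concatLoops, this, h0, h1]

theorem continuousOn_concatLoops {X : Type*} [TopologicalSpace X] {g : ℕ → ℝ → X} {q : X}
    (h0 : ∀ k, g k 0 = q) (h1 : ∀ k, g k 1 = q) (hg : ∀ k, ContinuousOn (g k) (Icc 0 1)) :
    ContinuousOn (concatLoops g) (Ici 0) := by
  have hlf : LocallyFinite fun k : ℕ => Icc (k : ℝ) (k + 1) :=
    (locallyFinite_Icc_of_tendsto (f := fun k : ℤ => (k : ℝ)) (g := fun k : ℤ => (k : ℝ) + 1)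
      tendsto_intCast_atTop_atTop
      (tendsto_atBot_add_const_right _ _ (tendsto_intCast_atBot_iff.2 tendsto_id))).comp_injective
      Nat.cast_injective
  refine (hlf.continuousOn_iUnion (fun _ => isClosed_Icc) fun k => ?_).mono fun t ht =>
    mem_iUnion.2 ⟨⌊t⌋₊, Nat.floor_le ht, (Nat.lt_floor_add_one t).le⟩
  refine ContinuousOn.congr ?_ fun t ht => concatLoops_of_mem_Icc h0 h1 ht
  exact (hg k).comp (by fun_prop) fun t ht => ⟨by linarith [ht.1], by linarith [ht.2]⟩

/-- The limit set of a concatenation of loops which approximate a closed set `Z` better and better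
is `Z`. -/
theorem iInter_closure_concatLoops {X : Type*} [PseudoMetricSpace X] {g : ℕ → ℝ → X} {q : X}
    {Z : Set X} (hZ : IsClosed Z) (h0 : ∀ k, g k 0 = q) (h1 : ∀ k, g k 1 = q)
    (hnear : ∀ k : ℕ, ∀ t ∈ Icc (0 : ℝ) 1, ∃ z ∈ Z, dist (g k t) z < 1 / (k + 1))
    (hdense : ∀ k : ℕ, ∀ z ∈ Z, ∃ t ∈ Icc (0 : ℝ) 1, dist (g k t) z ≤ 1 / (k + 1)) :
    ⋂ T ∈ Ioi (0 : ℝ), closure (concatLoops g '' Ici T) = Z := by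
  refine Subset.antisymm (fun x hx => ?_) fun z hz => mem_iInter₂.2 fun T _ => ?_
  · rw [← hZ.closure_eq, Metric.mem_closure_iff]
    intro ε hε
    obtain ⟨k, hk⟩ := exists_nat_one_div_lt (half_pos hε)
    obtain ⟨_, ⟨t, ht, rfl⟩, hxt⟩ := Metric.mem_closure_iff.1
      (mem_iInter₂.1 hx (k + 1 : ℝ) (by simp only [mem_Ioi]; positivity)) _ (half_pos hε)
    have ht' : (k + 1 : ℝ) ≤ t := ht
    have ht0 : 0 ≤ t := le_trans (by positivity) ht'
    obtain ⟨z, hz, hzt⟩ := hnear ⌊t⌋₊ (t - ⌊t⌋₊)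
      ⟨sub_nonneg.2 (Nat.floor_le ht0), by linarith [Nat.lt_floor_add_one t]⟩
    have hkt : (k : ℝ) ≤ ⌊t⌋₊ := Nat.cast_le.2 (Nat.le_floor (by linarith))
    have hle : 1 / ((⌊t⌋₊ : ℝ) + 1) ≤ 1 / (k + 1) := by gcongr
    refine ⟨z, hz, (dist_triangle _ (concatLoops g t) _).trans_lt ?_⟩
    change dist (concatLoops g t) z < _ at hzt
    linarith
  · rw [Metric.mem_closure_iff]
    intro ε hε
    obtain ⟨m, hm⟩ := exists_nat_one_div_lt hε
    obtain ⟨l, hl⟩ := exists_nat_ge T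
    obtain ⟨t, ht, htz⟩ := hdense (max m l) z hz
    have hle : 1 / (((max m l : ℕ) : ℝ) + 1) ≤ 1 / (m + 1) := by
      gcongr
      exact le_max_left m l
    have hlm : (l : ℝ) ≤ (max m l : ℕ) := Nat.cast_le.2 (le_max_right m l)
    refine ⟨_, ⟨(max m l : ℕ) + t, ?_, rfl⟩, ?_⟩
    · simp only [mem_Ici]
      linarith [ht.1]
    · rw [concatLoops_of_mem_Icc h0 h1 (k := max m l) ⟨by linarith [ht.1], by linarith [ht.2]⟩,
        add_sub_cancel_left, dist_comm]
      linarith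


/-- Let `L` be the set of nonnegative unit vectors in `ℝ^n`, let `Z ⊆ L`
be compact and connected, and fix `q ∈ Z`.  Then for every `δ > 0` there is a loop
`γ : [0,1] → L` based at `q`, contained in the open `δ`-neighborhood of `Z` intersected
with `L`, and passing within `δ` of every point of `Z`.  Consequently there is a
continuous path `γ : [0,∞) → L` with `Z = ⋂_{T>0} closure (γ([T,∞)))`. -/
theorem stmt13 (n : ℕ) (hn : 1 ≤ n)
    (L : Set (EuclideanSpace ℝ (Fin n)))
    (hL : L = {y : EuclideanSpace ℝ (Fin n) | ‖y‖ = 1 ∧ ∀ i, 0 ≤ y i})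
    (Z : Set (EuclideanSpace ℝ (Fin n))) (hZL : Z ⊆ L)
    (hZc : IsCompact Z) (hZconn : IsConnected Z)
    (q : EuclideanSpace ℝ (Fin n)) (hq : q ∈ Z) :
    (∀ δ : ℝ, 0 < δ →
      ∃ γ : ℝ → EuclideanSpace ℝ (Fin n),
        ContinuousOn γ (Set.Icc 0 1) ∧ γ 0 = q ∧ γ 1 = q ∧
        (∀ t ∈ Set.Icc (0 : ℝ) 1, γ t ∈ L ∧ ∃ z ∈ Z, ‖γ t - z‖ < δ) ∧
        (∀ z ∈ Z, ∃ t ∈ Set.Icc (0 : ℝ) 1, ‖γ t - z‖ ≤ δ)) ∧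
    (∃ γ : ℝ → EuclideanSpace ℝ (Fin n),
      ContinuousOn γ (Set.Ici 0) ∧ (∀ t : ℝ, 0 ≤ t → γ t ∈ L) ∧
      Z = ⋂ T ∈ Set.Ioi (0 : ℝ), closure (γ '' Set.Ici T)) := by
  have loops : ∀ δ : ℝ, 0 < δ →
      ∃ γ : ℝ → EuclideanSpace ℝ (Fin n),
        ContinuousOn γ (Set.Icc 0 1) ∧ γ 0 = q ∧ γ 1 = q ∧
        (∀ t ∈ Set.Icc (0 : ℝ) 1, γ t ∈ L ∧ ∃ z ∈ Z, ‖γ t - z‖ < δ) ∧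
        (∀ z ∈ Z, ∃ t ∈ Set.Icc (0 : ℝ) 1, ‖γ t - z‖ ≤ δ) := by
    intro δ hδ
    subst hL
    have hε : 0 < min (δ / 2) 1 := lt_min (half_pos hδ) one_pos
    obtain ⟨γ, hγU, hγZ⟩ := hZc.exists_loop_near
      (U := {p | ‖p‖ = 1 ∧ ∀ i, 0 ≤ p i} ∩ Metric.thickening δ Z) hZconn.isPreconnected hq
      (subset_inter hZL (Metric.self_subset_thickening hδ Z)) (fun x hx => by
        filter_upwards [self_mem_nhdsWithin,
          mem_nhdsWithin_of_mem_nhds (Metric.ball_mem_nhds x hε)] with y hy hxy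
        refine (joinedIn_nonneg_sphere_inter_ball (min_le_right _ _) (hZL hx).1 (hZL hx).2
          (hZL hy).1 (hZL hy).2 (mem_ball_iff_norm.1 hxy)).mono
          (inter_subset_inter_right _ ((Metric.ball_subset_ball ?_).trans
            (Metric.ball_subset_thickening hx δ)))
        linarith [min_le_left (δ / 2) 1]) hδ
    refine ⟨γ.extend, γ.continuous_extend.continuousOn, γ.extend_zero, γ.extend_one,
      fun t ht => ?_, fun z hz => ?_⟩
    · obtain ⟨h1, h2⟩ := hγU ⟨⟨t, ht⟩, (γ.extend_apply ht).symm⟩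
      obtain ⟨z, hz, hzt⟩ := Metric.mem_thickening_iff.1 h2
      exact ⟨h1, z, hz, by rwa [← dist_eq_norm]⟩
    · obtain ⟨t, ht⟩ := hγZ z hz
      exact ⟨t, t.2, by rw [γ.extend_extends', ← dist_eq_norm]; exact ht.le⟩
  refine ⟨loops, ?_⟩
  choose g hgc h0 h1 hnear hdense using fun k : ℕ => loops (1 / (k + 1)) Nat.one_div_pos_of_nat
  refine ⟨concatLoops g, continuousOn_concatLoops h0 h1 hgc, fun t ht => ?_, ?_⟩
  · exact (hnear _ _ ⟨sub_nonneg.2 (Nat.floor_le ht),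
      by linarith [Nat.lt_floor_add_one t]⟩).1
  · refine (iInter_closure_concatLoops hZc.isClosed h0 h1 (fun k t ht => ?_) fun k z hz => ?_).symm
    · simpa only [dist_eq_norm] using (hnear k t ht).2
    · simpa only [dist_eq_norm] using hdense k z hz
end
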